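/- arXiv:math/0604286 — 6 statements merged into one kernel-verified Lean document; each statement's English description precedes it below -/
import Mathlib

section
/- Isolatedness of nonresonant stationary solutions (Lemma 5.5): Let T > 0 and let V : ℝⁿ → ℝ be C² with (∇V)⁻¹(0) finite. Let p ∈ ℝⁿ with ∇V(p) = 0 and suppose no eigenvalue of the Hessian matrix D²V(p) belongs to {4k²π²/T² : k ∈ ℕ, k ≥ 1}. Then there exists ε > 0 such that every T-periodic solution u of ẍ = −∇V(x) satisfying sup_{t∈ℝ}(‖u(t) − p‖ + ‖u'(t)‖) < ε is identically equal to p. -/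
open Real

/-- The squared distances from a real number to the nonzero resonances `4 k² π² / T²` are bounded
below by a positive constant as soon as they are all positive. -/
lemma exists_pos_le_sq_sub_resonance {T : ℝ} (hT : 0 < T) {μ : ℝ}
    (hμ : ∀ k : ℕ, 1 ≤ k → μ ≠ 4 * (k : ℝ) ^ 2 * π ^ 2 / T ^ 2) :
    ∃ c > (0 : ℝ), ∀ m : ℤ, m ≠ 0 → c ≤ (μ - 4 * (m : ℝ) ^ 2 * π ^ 2 / T ^ 2) ^ 2 := by
  have h_atTop : Filter.Tendsto (fun k : ℕ => |4 * ((k + 1 : ℕ) : ℝ) ^ 2 * π ^ 2 / T ^ 2 - μ|)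
      Filter.cofinite Filter.atTop := by
    rw [Nat.cofinite_eq_atTop]
    refine Filter.tendsto_abs_atTop_atTop.comp ?_
    refine Filter.tendsto_atTop_add_const_right _ (-μ) ?_
    have h_sq : Filter.Tendsto (fun k : ℕ => ((k + 1 : ℕ) : ℝ) ^ 2) Filter.atTop Filter.atTop :=
      (Filter.tendsto_pow_atTop two_ne_zero).comp
        (tendsto_natCast_atTop_atTop.comp (Filter.tendsto_add_atTop_nat 1))
    have h_pos : 0 < 4 * π ^ 2 / T ^ 2 := by positivity
    refine (h_sq.const_mul_atTop h_pos).congr fun k => ?_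
    ring
  obtain ⟨k₀, hk₀⟩ := h_atTop.exists_forall_le
  have h_ne : 4 * ((k₀ + 1 : ℕ) : ℝ) ^ 2 * π ^ 2 / T ^ 2 - μ ≠ 0 :=
    sub_ne_zero.2 (hμ (k₀ + 1) (by omega)).symm
  refine ⟨|4 * ((k₀ + 1 : ℕ) : ℝ) ^ 2 * π ^ 2 / T ^ 2 - μ| ^ 2, by positivity, fun m hm => ?_⟩
  have h := hk₀ (m.natAbs - 1)
  rw [Nat.sub_add_cancel (by omega), Nat.cast_natAbs, Int.cast_abs, sq_abs] at h
  calc _ ≤ |4 * (m : ℝ) ^ 2 * π ^ 2 / T ^ 2 - μ| ^ 2 := by gcongr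
    _ = _ := by rw [sq_abs]; ring

/-- Fourier coefficients of the derivative of a function with equal values at the endpoints. -/
lemma fourierCoeffOn_deriv_of_eq_endpoints {T : ℝ} (hT : 0 < T) {f f' : ℝ → ℂ} {m : ℤ} (hm : m ≠ 0)
    (hf : ∀ t, HasDerivAt f (f' t) t) (hf' : Continuous f') (hper : f T = f 0) :
    fourierCoeffOn hT f' m = 2 * π * Complex.I * m / T * fourierCoeffOn hT f m := by
  have h := fourierCoeffOn_of_hasDerivAt hT hm (fun t _ => hf t) (hf'.intervalIntegrable _ _)
  have hT' : (T : ℂ) ≠ 0 := by exact_mod_cast hT.ne'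
  have hm' : (m : ℂ) ≠ 0 := by exact_mod_cast hm
  have hπ : (π : ℂ) ≠ 0 := by exact_mod_cast pi_ne_zero
  rw [h, hper]
  field_simp [Complex.I_ne_zero]
  simp

/-- A nonresonant `μ` makes `f ↦ f'' + μ f` bounded below in `L²` on periodic functions of mean
zero. -/
lemma exists_mul_integral_sq_le_scalar {T : ℝ} (hT : 0 < T) {μ : ℝ}
    (hμ : ∀ k : ℕ, 1 ≤ k → μ ≠ 4 * (k : ℝ) ^ 2 * π ^ 2 / T ^ 2) :
    ∃ c > (0 : ℝ), ∀ f f' f'' : ℝ → ℝ, (∀ t, HasDerivAt f (f' t) t) →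
      (∀ t, HasDerivAt f' (f'' t) t) → Continuous f'' → f T = f 0 → f' T = f' 0 →
      ∫ t in 0..T, f t = 0 →
      c * ∫ t in 0..T, f t ^ 2 ≤ ∫ t in 0..T, (f'' t + μ * f t) ^ 2 := by
  obtain ⟨c, hc, hcm⟩ := exists_pos_le_sq_sub_resonance hT hμ
  refine ⟨c, hc, fun f f' f'' hf hf' hf'' hper hper' hmean => ?_⟩
  have hf_cont : Continuous f := continuous_iff_continuousAt.2 fun t => (hf t).continuousAt
  have hf'_cont : Continuous f' := continuous_iff_continuousAt.2 fun t => (hf' t).continuousAt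
  set F : ℝ → ℂ := fun t => (f t : ℂ) with hF
  set G : ℝ → ℂ := fun t => ((f'' t + μ * f t : ℝ) : ℂ) with hG
  have hF_cont : Continuous F := by fun_prop
  have hG_cont : Continuous G := by fun_prop
  have h_memLp : ∀ g : ℝ → ℂ, Continuous g →
      MeasureTheory.MemLp g 2 (MeasureTheory.volume.restrict (Set.Ioc 0 T)) := fun g hg =>
    (MeasureTheory.memLp_two_iff_integrable_sq_norm hg.aestronglyMeasurable).2
      (Continuous.integrableOn_Ioc (by fun_prop))
  have h_sumF := hasSum_sq_fourierCoeffOn hT (h_memLp F hF_cont)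
  have h_sumG := hasSum_sq_fourierCoeffOn hT (h_memLp G hG_cont)
  have h_coeff : ∀ m : ℤ, c * ‖fourierCoeffOn hT F m‖ ^ 2 ≤ ‖fourierCoeffOn hT G m‖ ^ 2 := by
    intro m
    rcases eq_or_ne m 0 with rfl | hm
    · have h_zero : fourierCoeffOn hT F 0 = 0 := by
        rw [fourierCoeffOn_eq_integral]
        simp [hF, intervalIntegral.integral_ofReal, hmean]
      rw [h_zero]
      simp
    · have h_add : fourierCoeffOn hT G m =
          fourierCoeffOn hT (fun t => (f'' t : ℂ)) m + μ * fourierCoeffOn hT F m := by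
        have hcont : Continuous fun t : ℝ => fourier (-m) (t : AddCircle (T - 0)) :=
          (fourier (-m)).continuous.comp (AddCircle.continuous_mk' _)
        rw [← fourierCoeffOn.const_mul]
        simp only [fourierCoeffOn_eq_integral]
        rw [← smul_add, ← intervalIntegral.integral_add]
        · simp [hG, hF, mul_add]
        · exact (hcont.smul (by fun_prop)).intervalIntegrable _ _
        · exact (hcont.smul (by fun_prop)).intervalIntegrable _ _
      have h_one := fourierCoeffOn_deriv_of_eq_endpoints hT hm (fun t => (hf t).ofReal_comp)
        (by fun_prop) (by rw [hper])
      have h_two := fourierCoeffOn_deriv_of_eq_endpoints hT hm (fun t => (hf' t).ofReal_comp)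
        (by fun_prop) (by rw [hper'])
      have hG_coeff : fourierCoeffOn hT G m =
          ((μ - 4 * (m : ℝ) ^ 2 * π ^ 2 / T ^ 2 : ℝ) : ℂ) * fourierCoeffOn hT F m := by
        rw [h_add, h_two, h_one]
        push_cast
        ring_nf
        rw [Complex.I_sq]
        ring
      rw [hG_coeff, norm_mul, mul_pow, Complex.norm_real, Real.norm_eq_abs, sq_abs]
      exact mul_le_mul_of_nonneg_right (hcm m hm) (by positivity)
  have h_le := hasSum_le h_coeff (h_sumF.mul_left c) h_sumG
  simp only [hF, hG, Complex.norm_real, Real.norm_eq_abs, sq_abs, smul_eq_mul, sub_zero] at h_le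
  rw [mul_left_comm] at h_le
  exact le_of_mul_le_mul_left h_le (by positivity)

/-- A symmetric operator `A` without resonant eigenvalue makes `w ↦ w'' + A w` bounded below in
`L²` on periodic functions of mean zero. -/
lemma exists_mul_integral_sq_le {T : ℝ} (hT : 0 < T) {E : Type*} [NormedAddCommGroup E]
    [InnerProductSpace ℝ E] [FiniteDimensional ℝ E] (A : E →L[ℝ] E)
    (hA : (A : E →ₗ[ℝ] E).IsSymmetric)
    (hres : ∀ k : ℕ, 1 ≤ k → ∀ x : E, A x = (4 * (k : ℝ) ^ 2 * π ^ 2 / T ^ 2) • x → x = 0) :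
    ∃ c > (0 : ℝ), ∀ w w' w'' : ℝ → E, (∀ t, HasDerivAt w (w' t) t) →
      (∀ t, HasDerivAt w' (w'' t) t) → Continuous w'' → w T = w 0 → w' T = w' 0 →
      ∫ t in 0..T, w t = 0 →
      c * ∫ t in 0..T, ‖w t‖ ^ 2 ≤ ∫ t in 0..T, ‖w'' t + A (w t)‖ ^ 2 := by
  let b := hA.eigenvectorBasis rfl
  let μ := hA.eigenvalues rfl
  have hμ : ∀ i, ∀ k : ℕ, 1 ≤ k → μ i ≠ 4 * (k : ℝ) ^ 2 * π ^ 2 / T ^ 2 := by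
    intro i k hk h
    refine b.orthonormal.ne_zero i (hres k hk _ ?_)
    rw [← h]
    exact hA.apply_eigenvectorBasis rfl i
  choose C hC_pos hC using fun i => exists_mul_integral_sq_le_scalar hT (hμ i)
  obtain ⟨c, hc, hcC⟩ : ∃ c > (0 : ℝ), ∀ i, c ≤ C i := by
    cases isEmpty_or_nonempty (Fin (Module.finrank ℝ E)) with
    | inl h => exact ⟨1, one_pos, fun i => h.elim i⟩
    | inr h =>
      obtain ⟨i₀, hi₀⟩ := Finite.exists_min C
      exact ⟨C i₀, hC_pos i₀, hi₀⟩
  refine ⟨c, hc, fun w w' w'' hw hw' hw'' hper hper' hmean => ?_⟩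
  have hw_cont : Continuous w := continuous_iff_continuousAt.2 fun t => (hw t).continuousAt
  have h_parseval : ∀ x : E, ‖x‖ ^ 2 = ∑ i, (innerSL ℝ (b i) x) ^ 2 := by
    intro x
    simp [← b.sum_sq_norm_inner_right x]
  have h_eigen : ∀ i x, innerSL ℝ (b i) (A x) = μ i * innerSL ℝ (b i) x := by
    intro i x
    simpa [b, OrthonormalBasis.repr_apply_apply] using
      hA.eigenvectorBasis_apply_self_apply rfl x i
  simp only [h_parseval]
  rw [intervalIntegral.integral_finsetSum, intervalIntegral.integral_finsetSum, Finset.mul_sum]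
  · refine Finset.sum_le_sum fun i _ => ?_
    have h_int : 0 ≤ ∫ t in 0..T, (innerSL ℝ (b i) (w t)) ^ 2 :=
      intervalIntegral.integral_nonneg hT.le fun t _ => sq_nonneg _
    refine (mul_le_mul_of_nonneg_right (hcC i) h_int).trans ?_
    simp only [map_add, h_eigen]
    refine hC i _ (fun t => innerSL ℝ (b i) (w' t)) _
      (fun t => (innerSL ℝ (b i)).hasFDerivAt.comp_hasDerivAt t (hw t))
      (fun t => (innerSL ℝ (b i)).hasFDerivAt.comp_hasDerivAt t (hw' t))
      ((innerSL ℝ (b i)).continuous.comp hw'') (by simp [hper]) (by simp [hper']) ?_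
    rw [(innerSL ℝ (b i)).intervalIntegral_comp_comm (hw_cont.intervalIntegrable _ _), hmean,
      map_zero]
  · intro i _
    exact Continuous.intervalIntegrable (by fun_prop) _ _
  · intro i _
    exact Continuous.intervalIntegrable (by fun_prop) _ _

lemma contDiff_gradient {E : Type*} [NormedAddCommGroup E] [InnerProductSpace ℝ E]
    [CompleteSpace E] {V : E → ℝ} (hV : ContDiff ℝ 2 V) : ContDiff ℝ 1 (gradient V) :=
  (InnerProductSpace.toDual ℝ E).symm.contDiff.comp (hV.fderiv_right (by norm_num))

lemma isSymmetric_fderiv_gradient {E : Type*} [NormedAddCommGroup E] [InnerProductSpace ℝ E]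
    [CompleteSpace E] {V : E → ℝ} (hV : ContDiff ℝ 2 V) (p : E) :
    (fderiv ℝ (gradient V) p : E →ₗ[ℝ] E).IsSymmetric := by
  have h_inner : ∀ x y, inner ℝ (fderiv ℝ (gradient V) p x) y =
      fderiv ℝ (fderiv ℝ V) p x y := by
    intro x y
    have h : HasFDerivAt (gradient V) _ p :=
      ((contDiff_gradient hV).differentiable one_ne_zero p).hasFDerivAt
    have h' := (InnerProductSpace.toDual ℝ E).toContinuousLinearEquiv.hasFDerivAt.comp p h
    have h_eq : (InnerProductSpace.toDual ℝ E).toContinuousLinearEquiv ∘ gradient V =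
        fderiv ℝ V := toDual_comp_gradient
    rw [h_eq] at h'
    rw [h'.fderiv]
    simp
  intro x y
  have h_symm : IsSymmSndFDerivAt ℝ V p := hV.contDiffAt.isSymmSndFDerivAt (by simp)
  have h := h_symm.eq x y
  rw [← h_inner, ← h_inner, real_inner_comm] at h
  rw [real_inner_comm]
  simpa [real_inner_comm] using h

/-- If `DF(x)` stays close to a nonresonant symmetric operator `A` near `p`, then periodic
solutions of `u'' = -F(u)` near `p` are stationary. -/
lemma exists_forall_periodic_solution_deriv_eq_zero {T : ℝ} (hT : 0 < T) {E : Type*}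
    [NormedAddCommGroup E] [InnerProductSpace ℝ E] [FiniteDimensional ℝ E] {F : E → E}
    (hF : ContDiff ℝ 1 F) {p : E} (hA : (fderiv ℝ F p : E →ₗ[ℝ] E).IsSymmetric)
    (hres : ∀ k : ℕ, 1 ≤ k → ∀ x : E,
      fderiv ℝ F p x = (4 * (k : ℝ) ^ 2 * π ^ 2 / T ^ 2) • x → x = 0) :
    ∃ ε > (0 : ℝ), ∀ u : ℝ → E, ContDiff ℝ 2 u → (∀ t, u (t + T) = u t) →
      (∀ t, deriv (deriv u) t = -F (u t)) → (∀ t, ‖u t - p‖ < ε) → ∀ t, deriv u t = 0 := by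
  obtain ⟨c, hc, hbound⟩ := exists_mul_integral_sq_le hT _ hA hres
  have hDF_cont : Continuous (fderiv ℝ F) := hF.continuous_fderiv one_ne_zero
  obtain ⟨ε, hε, hclose⟩ := Metric.continuousAt_iff.1 hDF_cont.continuousAt √(c / 2)
    (by positivity)
  refine ⟨ε, hε, fun u hu hper hode hnear => ?_⟩
  have hu' : ContDiff ℝ 1 (deriv u) := by
    have h : ContDiff ℝ (1 + 1) u := by simpa [one_add_one_eq_two] using hu
    exact (contDiff_succ_iff_deriv.1 h).2.2
  have hu_deriv : ∀ t, HasDerivAt u (deriv u t) t := fun t =>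
    (hu.differentiable two_ne_zero t).hasDerivAt
  have hw : ∀ t, HasDerivAt (deriv u) (-F (u t)) t := fun t => by
    rw [← hode t]
    exact (hu'.differentiable one_ne_zero t).hasDerivAt
  have hw' : ∀ t, HasDerivAt (fun s => -F (u s)) (-fderiv ℝ F (u t) (deriv u t)) t := fun t =>
    ((hF.differentiable one_ne_zero (u t)).hasFDerivAt.comp_hasDerivAt t (hu_deriv t)).neg
  have hw_cont : Continuous (deriv u) := hu'.continuous
  have hu_cont : Continuous u := hu.continuous
  have hper' : ∀ t, deriv u (t + T) = deriv u t := fun t => by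
    rw [← deriv_comp_add_const]
    simp only [hper]
  have h_w''_cont : Continuous fun t => -fderiv ℝ F (u t) (deriv u t) :=
    ((hDF_cont.comp hu_cont).clm_apply hw_cont).neg
  have huT : u T = u 0 := by simpa using hper 0
  have hwT : deriv u T = deriv u 0 := by simpa using hper' 0
  have h_le := hbound _ _ _ hw hw' h_w''_cont hwT (by simp [huT]) (by
    rw [intervalIntegral.integral_eq_sub_of_hasDerivAt (fun t _ => hu_deriv t)
      (hw_cont.intervalIntegrable _ _), huT, sub_self])
  have h_pointwise : ∀ t, ‖-fderiv ℝ F (u t) (deriv u t) + fderiv ℝ F p (deriv u t)‖ ^ 2 ≤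
      c / 2 * ‖deriv u t‖ ^ 2 := by
    intro t
    have h_op : ‖fderiv ℝ F (u t) - fderiv ℝ F p‖ < √(c / 2) := by
      rw [← dist_eq_norm]
      exact hclose (by simpa [dist_eq_norm] using hnear t)
    calc _ = ‖(fderiv ℝ F (u t) - fderiv ℝ F p) (deriv u t)‖ ^ 2 := by
          rw [← norm_neg, sub_apply]
          congr 2
          abel
      _ ≤ (√(c / 2) * ‖deriv u t‖) ^ 2 := by
          gcongr
          exact ContinuousLinearMap.le_of_opNorm_le _ h_op.le _
      _ = _ := by rw [mul_pow, Real.sq_sqrt (by positivity)]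
  have h_upper := intervalIntegral.integral_mono_on (μ := MeasureTheory.volume) hT.le
    (Continuous.intervalIntegrable (by fun_prop) _ _)
    (Continuous.intervalIntegrable (by fun_prop) _ _) fun t _ => h_pointwise t
  rw [intervalIntegral.integral_const_mul] at h_upper
  have h_int_nonpos : ∫ t in 0..T, ‖deriv u t‖ ^ 2 ≤ 0 := by nlinarith
  have h_zero_on : ∀ t ∈ Set.Icc 0 T, deriv u t = 0 := by
    by_contra! h
    obtain ⟨t, ht, hne⟩ := h
    have h_pos : 0 < ∫ t in 0..T, ‖deriv u t‖ ^ 2 :=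
      intervalIntegral.integral_pos hT (by fun_prop) (fun _ _ => by positivity)
        ⟨t, ht, by positivity⟩
    exact h_int_nonpos.not_gt h_pos
  intro t
  have h_periodic : Function.Periodic (deriv u) T := hper'
  obtain ⟨s, hs, hst⟩ := h_periodic.exists_mem_Ico₀ hT t
  rw [hst]
  exact h_zero_on s (Set.Ico_subset_Icc_self hs)


/-- Isolatedness of nonresonant stationary solutions (Lemma 5.5): if `p` is a
zero of `∇V`, `(∇V)⁻¹(0)` is finite, and no eigenvalue of the Hessian `D²V(p)`
belongs to `{4k²π²/T² : k ≥ 1}`, then every `T`-periodic solution of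
`ẍ = -∇V(x)` that is C¹-close enough to the constant solution `p` equals `p`. -/
theorem nonresonant_stationary_solution_isolated
    (T : ℝ) (hT : 0 < T) (n : ℕ)
    (V : EuclideanSpace ℝ (Fin n) → ℝ) (hV : ContDiff ℝ 2 V)
    (hfin : {x : EuclideanSpace ℝ (Fin n) | gradient V x = 0}.Finite)
    (p : EuclideanSpace ℝ (Fin n)) (hp : gradient V p = 0)
    -- no eigenvalue of D²V(p) is of the form 4k²π²/T², k ≥ 1
    (hres : ∀ k : ℕ, 1 ≤ k → ∀ x : EuclideanSpace ℝ (Fin n),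
      fderiv ℝ (gradient V) p x = ((4 * (k : ℝ) ^ 2 * π ^ 2) / T ^ 2) • x → x = 0) :
    ∃ ε > (0 : ℝ), ∀ u : ℝ → EuclideanSpace ℝ (Fin n),
      ContDiff ℝ 2 u → (∀ t, u (t + T) = u t) →
      (∀ t, deriv (deriv u) t = -gradient V (u t)) →
      (∀ t, ‖u t - p‖ + ‖deriv u t‖ < ε) →
      ∀ t, u t = p := by
  obtain ⟨ε, hε, hstat⟩ := exists_forall_periodic_solution_deriv_eq_zero hT
    (contDiff_gradient hV) (isSymmetric_fderiv_gradient hV p) hres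
  have h_nhds : ({x | gradient V x = 0} \ {p})ᶜ ∈ nhds p :=
    (hfin.subset Set.sdiff_subset).isClosed.isOpen_compl.mem_nhds (by simp)
  obtain ⟨r, hr, hball⟩ := Metric.mem_nhds_iff.1 h_nhds
  refine ⟨min ε r, lt_min hε hr, fun u hu hper hode hnear t => ?_⟩
  have h_dist : ∀ t, ‖u t - p‖ < min ε r := fun t =>
    (le_add_of_nonneg_right (norm_nonneg _)).trans_lt (hnear t)
  have h_deriv := hstat u hu hper hode fun t => (h_dist t).trans_le (min_le_left _ _)
  have h_grad : gradient V (u t) = 0 := by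
    have h := hode t
    rw [funext h_deriv] at h
    simpa using h.symm
  have h_mem := hball (mem_ball_iff_norm.2 ((h_dist t).trans_le (min_le_right _ _)))
  by_contra hne
  exact h_mem ⟨h_grad, hne⟩
end

section
/- Minimal periods of solutions accumulating at a stationary solution (second conclusion of Theorem 5.9): Let T > 0 and let V : ℝⁿ → ℝ be C² with (∇V)⁻¹(0) finite, and let p₀ ∈ (∇V)⁻¹(0). Suppose the constant solution p₀ is not isolated among T-periodic solutions of ẍ = −∇V(x), i.e. for every δ > 0 there exists a T-periodic solution u ≠ p₀ with sup_{t}(‖u(t) − p₀‖ + ‖u'(t)‖) < δ. Then the set R = {k ∈ ℕ, k ≥ 1 : 4k²π²/T² is an eigenvalue of D²V(p₀)} is nonempty, and there exists ε > 0 such that every non-constant T-periodic solution u with sup_{t}(‖u(t) − p₀‖ + ‖u'(t)‖) < ε has minimal period equal to T/d, where d is the greatest common divisor of some nonempty subset of R. -/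
open Real

section FourierIntegrals

variable {E : Type*} [NormedAddCommGroup E] [NormedSpace ℝ E]

/-- The `k`-th real Fourier integral of `f` over `[0, T]`, with phase `φ`. Phase `0` is the cosine
integral, phase `π / 2` the sine integral. -/
noncomputable def phaseCoeff (T : ℝ) (f : ℝ → E) (k : ℤ) (φ : ℝ) : E :=
  ∫ t in (0 : ℝ)..T, cos (2 * π * k / T * t - φ) • f t

theorem phaseCoeff_sub {T : ℝ} {f g : ℝ → E} (hf : Continuous f) (hg : Continuous g) (k : ℤ)
    (φ : ℝ) : phaseCoeff T (fun t => f t - g t) k φ = phaseCoeff T f k φ - phaseCoeff T g k φ := by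
  simp only [phaseCoeff, smul_sub]
  exact intervalIntegral.integral_sub (Continuous.intervalIntegrable (by fun_prop) _ _)
    (Continuous.intervalIntegrable (by fun_prop) _ _)

theorem phaseCoeff_neg (T : ℝ) (f : ℝ → E) (k : ℤ) (φ : ℝ) :
    phaseCoeff T f (-k) φ = phaseCoeff T f k (-φ) := by
  refine intervalIntegral.integral_congr fun t _ => ?_
  have : 2 * π * ((-k : ℤ) : ℝ) / T * t - φ = -(2 * π * k / T * t - -φ) := by
    push_cast
    ring
  simp only [this, cos_neg]

theorem phaseCoeff_eq_cos_sin {T : ℝ} {f : ℝ → E} (hf : Continuous f) (k : ℤ) (φ : ℝ) :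
    phaseCoeff T f k φ = cos φ • phaseCoeff T f k 0 + sin φ • phaseCoeff T f k (π / 2) := by
  simp only [phaseCoeff]
  rw [← intervalIntegral.integral_smul, ← intervalIntegral.integral_smul,
    ← intervalIntegral.integral_add
      (Continuous.intervalIntegrable (by fun_prop) _ _)
      (Continuous.intervalIntegrable (by fun_prop) _ _)]
  refine intervalIntegral.integral_congr fun t _ => ?_
  simp only [sub_zero, cos_sub_pi_div_two, smul_smul, ← add_smul]
  rw [cos_sub]
  ring_nf

theorem periodic_cos_phase {T : ℝ} (hT : 0 < T) (k : ℤ) (φ : ℝ) :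
    Function.Periodic (fun t => cos (2 * π * k / T * t - φ)) T := by
  intro t
  have : 2 * π * k / T * (t + T) - φ = (2 * π * k / T * t - φ) + k * (2 * π) := by
    field_simp
    ring
  simp only [this, cos_add_int_mul_two_pi]

theorem phaseCoeff_shift {T : ℝ} (hT : 0 < T) {f : ℝ → E} (hf : Function.Periodic f T) (k : ℤ)
    (φ q : ℝ) :
    phaseCoeff T (fun t => f (t + q)) k φ = phaseCoeff T f k (φ + 2 * π * k / T * q) := by
  have hper : Function.Periodic
      (fun t => cos (2 * π * k / T * t - (φ + 2 * π * k / T * q)) • f t) T := fun t => by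
    simp only [hf t, periodic_cos_phase hT k _ t]
  have h1 := intervalIntegral.integral_comp_add_right (a := 0) (b := T)
    (fun t => cos (2 * π * k / T * t - (φ + 2 * π * k / T * q)) • f t) q
  have h2 := hper.intervalIntegral_add_eq (0 + q) 0
  simp only [phaseCoeff]
  rw [zero_add] at h1 h2
  rw [zero_add, add_comm q T] at h2
  rw [← h2, ← h1]
  refine intervalIntegral.integral_congr fun t _ => ?_
  ring_nf

theorem phaseCoeff_shift_of_cos_eq_one {T : ℝ} (hT : 0 < T) {f : ℝ → E}
    (hf : Function.Periodic f T) {k : ℤ} {q : ℝ} (hq : cos (2 * π * k / T * q) = 1) (φ : ℝ) :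
    phaseCoeff T (fun t => f (t + q)) k φ = phaseCoeff T f k φ := by
  obtain ⟨j, hj⟩ := (cos_eq_one_iff _).1 hq
  rw [phaseCoeff_shift hT hf, ← hj]
  refine intervalIntegral.integral_congr fun t _ => ?_
  simp only [← sub_sub, cos_sub_int_mul_two_pi]

/-- A period of `f` rotates every non-vanishing harmonic by a multiple of a full turn. -/
theorem cos_eq_one_of_period {T : ℝ} (hT : 0 < T) {f : ℝ → E} (hf : Continuous f)
    (hper : Function.Periodic f T) {k : ℤ} {q φ : ℝ} (hq : ∀ t, f (t + q) = f t)
    (hk : phaseCoeff T f k φ ≠ 0) : cos (2 * π * k / T * q) = 1 := by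
  have hrot : ∀ ψ, phaseCoeff T f k (ψ + 2 * π * k / T * q) = phaseCoeff T f k ψ := fun ψ => by
    rw [← phaseCoeff_shift hT hper]
    simp only [hq]
  set θ := 2 * π * k / T * q
  have hsum : phaseCoeff T f k (φ + θ) + phaseCoeff T f k (φ - θ) =
      (2 * cos θ) • phaseCoeff T f k φ := by
    rw [phaseCoeff_eq_cos_sin hf k (φ + θ), phaseCoeff_eq_cos_sin hf k (φ - θ),
      phaseCoeff_eq_cos_sin hf k φ, cos_add, cos_sub, sin_add, sin_sub]
    module
  have hminus := hrot (φ - θ)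
  rw [sub_add_cancel] at hminus
  rw [hrot, ← hminus, ← two_smul ℝ] at hsum
  have := smul_left_injective ℝ hk hsum
  linarith

/-- Integrating by parts twice against a harmonic. -/
theorem phaseCoeff_deriv_deriv {T : ℝ} (hT : 0 < T) [CompleteSpace E] {f : ℝ → E}
    (hf : ContDiff ℝ 2 f)
    (hper : Function.Periodic f T) (k : ℤ) (φ : ℝ) :
    phaseCoeff T (deriv (deriv f)) k φ = -((2 * π * k / T) ^ 2 • phaseCoeff T f k φ) := by
  set ω := 2 * π * k / T
  have hf1 : ContDiff ℝ 1 (deriv f) := (contDiff_succ_iff_deriv.1 hf).2.2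
  have hf2 : Continuous (deriv (deriv f)) := hf1.continuous_deriv le_rfl
  have hfc := hf.continuous
  have hd : ∀ t, HasDerivAt (fun t => cos (ω * t - φ) • deriv f t + (ω * sin (ω * t - φ)) • f t)
      (cos (ω * t - φ) • deriv (deriv f) t + ω ^ 2 • cos (ω * t - φ) • f t) t := fun t => by
    have h1 : HasDerivAt (fun t => ω * t - φ) ω t := by
      simpa using ((hasDerivAt_id t).const_mul ω).sub_const φ
    have h2 := h1.cos.smul ((hf1.differentiable one_ne_zero) t).hasDerivAt
    have h3 := (h1.sin.const_mul ω).smul ((hf.differentiable two_ne_zero) t).hasDerivAt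
    exact (h2.add h3).congr_deriv (by module)
  have hderper : deriv f T = deriv f 0 := by
    have : (fun t => f (t + T)) = f := funext hper
    have h := deriv_comp_add_const f T 0
    rw [this, zero_add] at h
    exact h.symm
  have hcT : cos (ω * T - φ) = cos (ω * 0 - φ) := by
    simpa using periodic_cos_phase hT k φ 0
  have hsT : sin (ω * T - φ) = sin (ω * 0 - φ) := by
    have := periodic_cos_phase hT k (φ + π / 2) 0
    simpa only [zero_add, ← sub_sub, cos_sub_pi_div_two] using this
  have hfT : f T = f 0 := by simpa using hper 0
  have hint := intervalIntegral.integral_eq_sub_of_hasDerivAt (a := 0) (b := T) (fun t _ => hd t)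
    (Continuous.intervalIntegrable (by fun_prop) _ _)
  rw [hderper, hcT, hsT, hfT, sub_self, intervalIntegral.integral_add
      (Continuous.intervalIntegrable (by fun_prop) _ _)
      (Continuous.intervalIntegrable (by fun_prop) _ _), intervalIntegral.integral_smul] at hint
  exact eq_neg_of_add_eq_zero_left hint

theorem phaseCoeff_clm {F : Type*} [NormedAddCommGroup F] [NormedSpace ℝ F] [CompleteSpace E]
    [CompleteSpace F] {T : ℝ} {f : ℝ → E} (hf : Continuous f) (A : E →L[ℝ] F) (k : ℤ) (φ : ℝ) :
    phaseCoeff T (fun t => A (f t)) k φ = A (phaseCoeff T f k φ) := by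
  simp only [phaseCoeff]
  rw [← A.intervalIntegral_comp_comm (Continuous.intervalIntegrable (by fun_prop) _ _)]
  simp only [map_smul]

end FourierIntegrals

theorem hasSum_phaseCoeff_sq_real {T : ℝ} (hT : 0 < T) {f : ℝ → ℝ} (hf : Continuous f) :
    HasSum (fun k : ℤ => phaseCoeff T f k 0 ^ 2 + phaseCoeff T f k (π / 2) ^ 2)
      (T * ∫ t in (0 : ℝ)..T, f t ^ 2) := by
  have hL2 : MeasureTheory.MemLp (fun t => (f t : ℂ)) 2
      (MeasureTheory.volume.restrict (Set.Ioc 0 T)) := by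
    have hfc : Continuous fun t => (f t : ℂ) := Complex.continuous_ofReal.comp hf
    obtain ⟨C, hC⟩ := isCompact_Icc.exists_bound_of_continuousOn
      (hfc.continuousOn (s := Set.Icc 0 T))
    refine MeasureTheory.MemLp.of_bound hfc.aestronglyMeasurable C ?_
    exact (MeasureTheory.ae_restrict_iff' measurableSet_Ioc).2
      (.of_forall fun t ht => hC t (Set.Ioc_subset_Icc_self ht))
  have h := (hasSum_sq_fourierCoeffOn hT hL2).mul_left (T ^ 2)
  have hcoeff : ∀ k : ℤ, fourierCoeffOn hT (fun t => (f t : ℂ)) k =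
      (1 / T : ℝ) •
        (((phaseCoeff T f k 0 : ℝ) : ℂ) - (phaseCoeff T f k (π / 2) : ℝ) * Complex.I) := fun k => by
    rw [fourierCoeffOn_eq_integral, sub_zero]
    congr 1
    simp only [phaseCoeff]
    rw [← intervalIntegral.integral_ofReal, ← intervalIntegral.integral_ofReal,
      ← intervalIntegral.integral_mul_const, ← intervalIntegral.integral_sub
      (Continuous.intervalIntegrable (by fun_prop) _ _)
      (Continuous.intervalIntegrable (by fun_prop) _ _)]
    refine intervalIntegral.integral_congr fun t _ => ?_
    simp only [sub_zero, cos_sub_pi_div_two, smul_eq_mul]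
    have : (2 * π * Complex.I * ((-k : ℤ) : ℂ) * t / (T : ℂ)) =
        ((-(2 * π * k / T * t) : ℝ) : ℂ) * Complex.I := by
      push_cast
      ring
    rw [fourier_coe_apply, this, Complex.exp_mul_I, ← Complex.ofReal_cos, ← Complex.ofReal_sin,
      cos_neg, sin_neg]
    push_cast
    ring
  have hterm : ∀ k : ℤ, T ^ 2 * ‖fourierCoeffOn hT (fun t => (f t : ℂ)) k‖ ^ 2 =
      phaseCoeff T f k 0 ^ 2 + phaseCoeff T f k (π / 2) ^ 2 := fun k => by
    have hns : ∀ a b : ℝ, ‖(a : ℂ) - b * Complex.I‖ ^ 2 = a ^ 2 + b ^ 2 := fun a b => by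
      rw [Complex.sq_norm, Complex.normSq_apply]
      simp
      ring
    rw [hcoeff, norm_smul, mul_pow, hns, norm_of_nonneg (by positivity)]
    field_simp
  have hlim : T ^ 2 * (T - 0)⁻¹ • ∫ t in (0 : ℝ)..T, ‖(f t : ℂ)‖ ^ 2 =
      T * ∫ t in (0 : ℝ)..T, f t ^ 2 := by
    simp only [Complex.norm_real, norm_eq_abs, sq_abs, smul_eq_mul, sub_zero]
    field_simp
  simp only [hterm, hlim] at h
  exact h

theorem hasSum_phaseCoeff_sq {T : ℝ} (hT : 0 < T) {n : ℕ} {f : ℝ → EuclideanSpace ℝ (Fin n)}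
    (hf : Continuous f) :
    HasSum (fun k : ℤ => ‖phaseCoeff T f k 0‖ ^ 2 + ‖phaseCoeff T f k (π / 2)‖ ^ 2)
      (T * ∫ t in (0 : ℝ)..T, ‖f t‖ ^ 2) := by
  have hfi : ∀ i, Continuous fun t => f t i := fun i =>
    (EuclideanSpace.proj (𝕜 := ℝ) i).continuous.comp hf
  have h := hasSum_sum (s := Finset.univ) fun i _ => hasSum_phaseCoeff_sq_real hT (hfi i)
  have hterm : ∀ k : ℤ, ∑ i, (phaseCoeff T (fun t => f t i) k 0 ^ 2 +
      phaseCoeff T (fun t => f t i) k (π / 2) ^ 2) =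
      ‖phaseCoeff T f k 0‖ ^ 2 + ‖phaseCoeff T f k (π / 2)‖ ^ 2 := fun k => by
    rw [EuclideanSpace.real_norm_sq_eq, EuclideanSpace.real_norm_sq_eq, ← Finset.sum_add_distrib]
    have hi : ∀ i φ, phaseCoeff T (fun t => f t i) k φ = phaseCoeff T f k φ i := fun i φ =>
      phaseCoeff_clm hf (EuclideanSpace.proj (𝕜 := ℝ) i) k φ
    simp only [hi]
  have hsq : ∀ i, Continuous fun t => f t i ^ 2 := fun i => (hfi i).pow 2
  have hlim : ∑ i, T * ∫ t in (0 : ℝ)..T, f t i ^ 2 = T * ∫ t in (0 : ℝ)..T, ‖f t‖ ^ 2 := by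
    simp only [EuclideanSpace.real_norm_sq_eq]
    rw [← Finset.mul_sum, intervalIntegral.integral_finsetSum
      fun i _ => (hsq i).intervalIntegrable _ _]
  simp only [hterm, hlim] at h
  exact h

/-- `L²` bound for `T`-periodic solutions of `ẅ + A w = h`, provided that `A - (2πk/T)²` is
bounded below at all frequencies `k` present in `w`. -/
theorem integral_norm_sq_le_of_gap {T : ℝ} (hT : 0 < T) {n : ℕ}
    {A : EuclideanSpace ℝ (Fin n) →L[ℝ] EuclideanSpace ℝ (Fin n)} {c : ℝ} (hc : 0 ≤ c)
    {w : ℝ → EuclideanSpace ℝ (Fin n)} (hw : ContDiff ℝ 2 w) (hper : Function.Periodic w T)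
    (hgap : ∀ k : ℤ, (∀ φ, phaseCoeff T w k φ = 0) ∨
      ∀ x, c * ‖x‖ ≤ ‖A x - (2 * π * k / T) ^ 2 • x‖) :
    c ^ 2 * ∫ t in (0 : ℝ)..T, ‖w t‖ ^ 2 ≤
      ∫ t in (0 : ℝ)..T, ‖A (w t) - -deriv (deriv w) t‖ ^ 2 := by
  have hwc := hw.continuous
  have hw2 : Continuous (deriv (deriv w)) :=
    ((contDiff_succ_iff_deriv.1 hw).2.2 : ContDiff ℝ 1 (deriv w)).continuous_deriv le_rfl
  have hcoeff : ∀ k φ, phaseCoeff T (fun t => A (w t) - -deriv (deriv w) t) k φ =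
      A (phaseCoeff T w k φ) - (2 * π * k / T) ^ 2 • phaseCoeff T w k φ := fun k φ => by
    have hneg : phaseCoeff T (fun t => -deriv (deriv w) t) k φ =
        -phaseCoeff T (deriv (deriv w)) k φ := by
      simp only [phaseCoeff, smul_neg, intervalIntegral.integral_neg]
    rw [phaseCoeff_sub (by fun_prop) (by fun_prop), phaseCoeff_clm hwc, hneg,
      phaseCoeff_deriv_deriv hT hw hper, neg_neg]
  have hle : ∀ k φ, c ^ 2 * ‖phaseCoeff T w k φ‖ ^ 2 ≤
      ‖phaseCoeff T (fun t => A (w t) - -deriv (deriv w) t) k φ‖ ^ 2 := fun k φ => by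
    rcases hgap k with h | h
    · simp [h]
    · rw [hcoeff, ← mul_pow]
      exact pow_le_pow_left₀ (by positivity) (h _) 2
  have h1 := (hasSum_phaseCoeff_sq hT hwc).mul_left (c ^ 2)
  have h2 := hasSum_phaseCoeff_sq hT
    (by fun_prop : Continuous fun t => A (w t) - -deriv (deriv w) t)
  have h := hasSum_le (fun k => by
    have := hle k 0
    have := hle k (π / 2)
    linarith) h1 h2
  rw [mul_left_comm] at h
  exact le_of_mul_le_mul_left h hT

theorem eq_zero_of_integral_norm_sq_eq_zero {E : Type*} [NormedAddCommGroup E] {T : ℝ} (hT : 0 < T)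
    {w : ℝ → E} (hw : Continuous w) (hper : Function.Periodic w T)
    (h : ∫ t in (0 : ℝ)..T, ‖w t‖ ^ 2 = 0) (t : ℝ) : w t = 0 := by
  obtain ⟨s, hs, hst⟩ := hper.exists_mem_Ico₀ hT t
  rw [hst]
  by_contra hne
  refine (intervalIntegral.integral_pos hT (f := fun t => ‖w t‖ ^ 2) (by fun_prop)
    (fun _ _ => by positivity) ⟨s, Set.Ico_subset_Icc_self hs, ?_⟩).ne' h
  have := norm_pos_iff.2 hne
  positivity

/-- The positive integers `k` for which `(2πk/T)²` is an eigenvalue of `A`. -/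
def resonances {n : ℕ} (T : ℝ) (A : EuclideanSpace ℝ (Fin n) →L[ℝ] EuclideanSpace ℝ (Fin n)) :
    Set ℕ :=
  {k : ℕ | 1 ≤ k ∧ ∃ x : EuclideanSpace ℝ (Fin n), x ≠ 0 ∧
    A x = ((4 * (k : ℝ) ^ 2 * π ^ 2) / T ^ 2) • x}

section Resonances

variable {n : ℕ} {T : ℝ} {A : EuclideanSpace ℝ (Fin n) →L[ℝ] EuclideanSpace ℝ (Fin n)}

theorem exists_forall_norm_le_sub (hT : 0 < T)
    (A : EuclideanSpace ℝ (Fin n) →L[ℝ] EuclideanSpace ℝ (Fin n)) :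
    ∃ N : ℕ, ∀ k ≥ N, ∀ x, ‖x‖ ≤ ‖A x - ((4 * (k : ℝ) ^ 2 * π ^ 2) / T ^ 2) • x‖ := by
  have hlim : Filter.Tendsto (fun k : ℕ => (4 * (k : ℝ) ^ 2 * π ^ 2) / T ^ 2)
      Filter.atTop Filter.atTop := by
    have h := ((Filter.tendsto_pow_atTop two_ne_zero).comp
      tendsto_natCast_atTop_atTop).const_mul_atTop (show (0 : ℝ) < 4 * π ^ 2 / T ^ 2 by positivity)
    refine h.congr fun k => ?_
    simp only [Function.comp_apply]
    ring
  obtain ⟨N, hN⟩ := Filter.eventually_atTop.1 (hlim.eventually_ge_atTop (‖A‖ + 1))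
  refine ⟨N, fun k hk x => ?_⟩
  have h1 := norm_sub_norm_le (((4 * (k : ℝ) ^ 2 * π ^ 2) / T ^ 2) • x) (A x)
  rw [norm_sub_rev, norm_smul, norm_of_nonneg (by positivity)] at h1
  have h2 := A.le_opNorm x
  have h3 := mul_le_mul_of_nonneg_right (hN k hk) (norm_nonneg x)
  linarith

theorem finite_resonances (hT : 0 < T) : (resonances T A).Finite := by
  obtain ⟨N, hN⟩ := exists_forall_norm_le_sub hT A
  refine (Set.finite_Iio N).subset fun k hk => ?_
  obtain ⟨-, x, hx, hAx⟩ := hk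
  by_contra hkN
  have := hN k (not_lt.1 hkN) x
  rw [hAx, sub_self, norm_zero] at this
  exact hx (norm_le_zero_iff.1 this)

theorem exists_spectral_gap (hT : 0 < T) :
    ∃ c > 0, ∀ k : ℕ, 1 ≤ k → k ∉ resonances T A → ∀ x,
      c * ‖x‖ ≤ ‖A x - ((4 * (k : ℝ) ^ 2 * π ^ 2) / T ^ 2) • x‖ := by
  obtain ⟨N, hN⟩ := exists_forall_norm_le_sub hT A
  have hsingle : ∀ k : ℕ, ∃ c > 0, 1 ≤ k → k ∉ resonances T A → ∀ x,
      c * ‖x‖ ≤ ‖A x - ((4 * (k : ℝ) ^ 2 * π ^ 2) / T ^ 2) • x‖ := fun k => by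
    by_cases hk : 1 ≤ k ∧ k ∉ resonances T A
    · set B := A - ((4 * (k : ℝ) ^ 2 * π ^ 2) / T ^ 2) • ContinuousLinearMap.id ℝ _
      have hker : LinearMap.ker
          (B : EuclideanSpace ℝ (Fin n) →ₗ[ℝ] EuclideanSpace ℝ (Fin n)) = ⊥ := by
        refine LinearMap.ker_eq_bot'.2 fun x hx => ?_
        by_contra hne
        exact hk.2 ⟨hk.1, x, hne, sub_eq_zero.1 hx⟩
      obtain ⟨K, hK, hanti⟩ := LinearMap.exists_antilipschitzWith _ hker
      have hK' : (0 : ℝ) < K := hK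
      refine ⟨(K : ℝ)⁻¹, inv_pos.2 hK', fun _ _ x => ?_⟩
      have h := hanti.le_mul_dist x 0
      rw [dist_zero_right, map_zero, dist_zero_right] at h
      exact (inv_mul_le_iff₀ hK').2 h
    · exact ⟨1, one_pos, fun h1 h2 => absurd ⟨h1, h2⟩ hk⟩
  choose c hcpos hc using hsingle
  have hev : ∀ᶠ d in nhdsWithin (0 : ℝ) (Set.Ioi 0),
      (0 < d ∧ d ≤ 1) ∧ ∀ k ∈ Finset.range N, d ≤ c k := by
    refine ((eventually_mem_nhdsWithin).and ?_).and ?_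
    · exact Filter.Eventually.filter_mono nhdsWithin_le_nhds (eventually_le_nhds one_pos)
    · exact (Filter.eventually_all_finset _).2 fun k _ =>
        Filter.Eventually.filter_mono nhdsWithin_le_nhds (eventually_le_nhds (hcpos k))
  obtain ⟨d, ⟨hd0, hd1⟩, hd⟩ := hev.exists
  refine ⟨d, hd0, fun k hk1 hkR x => ?_⟩
  rcases lt_or_ge k N with hkN | hkN
  · exact (mul_le_mul_of_nonneg_right (hd k (Finset.mem_range.2 hkN)) (norm_nonneg x)).trans
      (hc k hk1 hkR x)
  · exact (mul_le_of_le_one_left (norm_nonneg x) hd1).trans (hN k hkN x)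

/-- Two `T`-periodic solutions of `ü = -F(u)` with the same resonant harmonics coincide, as long
as `F` is close enough to the linear map `A` along both. -/
theorem eq_of_resonant_phaseCoeff_eq (hT : 0 < T) {c : ℝ}
    (hgap : ∀ k : ℕ, 1 ≤ k → k ∉ resonances T A → ∀ x,
      c * ‖x‖ ≤ ‖A x - ((4 * (k : ℝ) ^ 2 * π ^ 2) / T ^ 2) • x‖)
    {F : EuclideanSpace ℝ (Fin n) → EuclideanSpace ℝ (Fin n)} {s : Set (EuclideanSpace ℝ (Fin n))}
    {η : NNReal} (hη : η < c) (hF : ApproximatesLinearOn F A s η)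
    {u v : ℝ → EuclideanSpace ℝ (Fin n)} (hu : ContDiff ℝ 2 u) (hv : ContDiff ℝ 2 v)
    (hup : Function.Periodic u T) (hvp : Function.Periodic v T)
    (hus : ∀ t, u t ∈ s) (hvs : ∀ t, v t ∈ s)
    (hueq : ∀ t, deriv (deriv u) t = -F (u t)) (hveq : ∀ t, deriv (deriv v) t = -F (v t))
    (hres : ∀ k : ℤ, k = 0 ∨ k.natAbs ∈ resonances T A → ∀ φ,
      phaseCoeff T u k φ = phaseCoeff T v k φ) (t : ℝ) : u t = v t := by
  have hc : 0 ≤ c := η.coe_nonneg.trans hη.le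
  set w := fun t => u t - v t with hwdef
  have hw : ContDiff ℝ 2 w := hu.sub hv
  have hwc := hw.continuous
  have hwp : Function.Periodic w T := hup.sub hvp
  have hu1 : ContDiff ℝ 1 (deriv u) := (contDiff_succ_iff_deriv.1 hu).2.2
  have hv1 : ContDiff ℝ 1 (deriv v) := (contDiff_succ_iff_deriv.1 hv).2.2
  have hw1 : deriv w = fun t => deriv u t - deriv v t := funext fun t =>
    deriv_fun_sub (hu.differentiable two_ne_zero t) (hv.differentiable two_ne_zero t)
  have hw2 : ∀ t, deriv (deriv w) t = -F (u t) - -F (v t) := fun t => by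
    rw [hw1, deriv_fun_sub (hu1.differentiable one_ne_zero t) (hv1.differentiable one_ne_zero t),
      hueq, hveq]
  have hw2c : Continuous (deriv (deriv w)) :=
    ((contDiff_succ_iff_deriv.1 hw).2.2 : ContDiff ℝ 1 (deriv w)).continuous_deriv le_rfl
  have hest := integral_norm_sq_le_of_gap hT (A := A) hc hw hwp fun k => by
    by_cases hk : k = 0 ∨ k.natAbs ∈ resonances T A
    · left
      intro φ
      rw [hwdef, phaseCoeff_sub hu.continuous hv.continuous, hres k hk, sub_self]
    · right
      push Not at hk
      have hsq : (4 * (k.natAbs : ℝ) ^ 2 * π ^ 2) / T ^ 2 = (2 * π * k / T) ^ 2 := by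
        rw [Nat.cast_natAbs, Int.cast_abs, sq_abs]
        ring
      rw [← hsq]
      exact hgap _ (Int.natAbs_pos.2 hk.1) hk.2
  have hpt : ∀ t, ‖A (w t) - -deriv (deriv w) t‖ ^ 2 ≤ η ^ 2 * ‖w t‖ ^ 2 := fun t => by
    rw [← mul_pow, norm_sub_rev]
    refine pow_le_pow_left₀ (norm_nonneg _) ?_ 2
    have h : -deriv (deriv w) t - A (w t) = F (u t) - F (v t) - A (u t - v t) := by
      rw [hw2]
      abel
    rw [h]
    exact hF _ (hus t) _ (hvs t)
  have hmono := intervalIntegral.integral_mono hT.le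
    (Continuous.intervalIntegrable (μ := MeasureTheory.volume) (by fun_prop) 0 T)
    (Continuous.intervalIntegrable (by fun_prop) 0 T) hpt
  rw [intervalIntegral.integral_const_mul] at hmono
  have hI : 0 ≤ ∫ t in (0 : ℝ)..T, ‖w t‖ ^ 2 :=
    intervalIntegral.integral_nonneg hT.le fun _ _ => by positivity
  have hlt : (η : ℝ) ^ 2 < c ^ 2 := pow_lt_pow_left₀ hη η.coe_nonneg two_ne_zero
  have hzero : ∫ t in (0 : ℝ)..T, ‖w t‖ ^ 2 = 0 := by
    nlinarith
  exact sub_eq_zero.1 (eq_zero_of_integral_norm_sq_eq_zero hT hwc hwp hzero t)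

end Resonances

theorem exists_int_eq_gcd_mul {S : Finset ℕ} {ρ : ℝ} (h : ∀ k ∈ S, ∃ j : ℤ, (k : ℝ) * ρ = j) :
    ∃ j : ℤ, ((S.gcd id : ℕ) : ℝ) * ρ = j := by
  induction S using Finset.induction_on with
  | empty => exact ⟨0, by simp⟩
  | insert a S _ ih =>
    obtain ⟨i, hi⟩ := h a (Finset.mem_insert_self a S)
    obtain ⟨j, hj⟩ := ih fun k hk => h k (Finset.mem_insert_of_mem hk)
    rw [Finset.gcd_insert, id_eq]
    set g := S.gcd id
    refine ⟨Nat.gcdA a g * i + Nat.gcdB a g * j, ?_⟩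
    have hb : ((Nat.gcd a g : ℕ) : ℝ) = a * Nat.gcdA a g + g * Nat.gcdB a g := by
      exact_mod_cast Nat.gcd_eq_gcd_ab a g
    rw [show GCDMonoid.gcd a g = Nat.gcd a g from rfl, hb]
    push_cast
    rw [← hi, ← hj]
    ring

/-- If the shifts fixing `u` are exactly those fixing all harmonics in `S`, the minimal period of
`u` is `T / gcd S`. -/
theorem isLeast_period_of_harmonics {E : Type*} {T : ℝ} (hT : 0 < T) {u : ℝ → E} {S : Finset ℕ}
    (hS : S.Nonempty) (hpos : ∀ k ∈ S, 1 ≤ k)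
    (h : ∀ q, (∀ t, u (t + q) = u t) ↔ ∀ k ∈ S, cos (2 * π * k / T * q) = 1) :
    IsLeast {q : ℝ | 0 < q ∧ ∀ t, u (t + q) = u t} (T / (S.gcd id : ℕ)) := by
  obtain ⟨k₀, hk₀⟩ := hS
  have hg : 0 < S.gcd id := Nat.pos_of_dvd_of_pos (Finset.gcd_dvd hk₀) (hpos k₀ hk₀)
  have hg' : (0 : ℝ) < (S.gcd id : ℕ) := by exact_mod_cast hg
  refine ⟨⟨by positivity, (h _).2 fun k hk => ?_⟩, fun q ⟨hq, hqu⟩ => ?_⟩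
  · obtain ⟨m, hm⟩ : S.gcd id ∣ k := Finset.gcd_dvd hk
    refine (cos_eq_one_iff _).2 ⟨m, ?_⟩
    have hm' : (k : ℝ) = (S.gcd id : ℕ) * m := by exact_mod_cast hm
    rw [hm']
    push_cast
    field_simp
  · obtain ⟨j, hj⟩ := exists_int_eq_gcd_mul (S := S) (ρ := q / T) fun k hk => by
      obtain ⟨j, hj⟩ := (cos_eq_one_iff _).1 ((h q).1 hqu k hk)
      refine ⟨j, ?_⟩
      field_simp at hj ⊢
      linarith
    have hjpos : (0 : ℝ) < j := by
      rw [← hj]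
      positivity
    have hj1 : (1 : ℝ) ≤ j := by exact_mod_cast hjpos
    rw [← hj] at hj1
    rw [div_le_iff₀ hg']
    have := mul_le_mul_of_nonneg_right hj1 hT.le
    field_simp at this
    linarith

/-- Non-constant `T`-periodic solutions of `ü = -F(u)` in a small neighbourhood of `p` have minimal
period `T / d` with `d` the gcd of a non-empty set of resonances of the linearization. -/
theorem eventually_minimal_period {n : ℕ} {T : ℝ} (hT : 0 < T)
    {F : EuclideanSpace ℝ (Fin n) → EuclideanSpace ℝ (Fin n)}
    {A : EuclideanSpace ℝ (Fin n) →L[ℝ] EuclideanSpace ℝ (Fin n)}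
    {p : EuclideanSpace ℝ (Fin n)} (hF : HasStrictFDerivAt F A p) :
    ∃ ε > (0 : ℝ), ∀ u : ℝ → EuclideanSpace ℝ (Fin n),
      ContDiff ℝ 2 u → (∀ t, u (t + T) = u t) → (∀ t, deriv (deriv u) t = -F (u t)) →
      (∃ t₁ t₂, u t₁ ≠ u t₂) → (∀ t, ‖u t - p‖ < ε) →
      ∃ s : Finset ℕ, s.Nonempty ∧ ↑s ⊆ resonances T A ∧
        IsLeast {q : ℝ | 0 < q ∧ ∀ t, u (t + q) = u t} (T / (s.gcd id : ℕ)) := by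
  obtain ⟨c, hc, hgap⟩ := exists_spectral_gap (A := A) hT
  obtain ⟨η, hη0, hηc⟩ : ∃ η : NNReal, 0 < η ∧ (η : ℝ) < c :=
    ⟨⟨c / 2, by positivity⟩, half_pos hc, half_lt_self hc⟩
  obtain ⟨s, hs, hFs⟩ := hF.approximates_deriv_on_nhds (Or.inr hη0)
  obtain ⟨ε, hε, hball⟩ := Metric.mem_nhds_iff.1 hs
  refine ⟨ε, hε, fun u hu hper hueq hne hclose => ?_⟩
  have hus : ∀ t, u t ∈ s := fun t => hball (mem_ball_iff_norm.2 (hclose t))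
  classical
  set S : Finset ℕ := (finite_resonances (A := A) hT).toFinset.filter
    fun k => ∃ φ, phaseCoeff T u k φ ≠ 0
  have hSR : ∀ k ∈ S, k ∈ resonances T A := fun k hk =>
    (Set.Finite.mem_toFinset _).1 (Finset.mem_filter.1 hk).1
  have hshift : ∀ q, (∀ t, u (t + q) = u t) ↔ ∀ k ∈ S, cos (2 * π * k / T * q) = 1 := by
    refine fun q => ⟨fun hq k hk => ?_, fun hq => ?_⟩
    · obtain ⟨φ, hφ⟩ := (Finset.mem_filter.1 hk).2
      exact_mod_cast cos_eq_one_of_period hT hu.continuous hper hq hφ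
    · refine eq_of_resonant_phaseCoeff_eq hT hgap hηc hFs (u := fun t => u (t + q)) (v := u)
        (by fun_prop) hu (fun t => by simp only [add_right_comm t T q, hper]) hper
        (fun t => hus _) hus (fun t => ?_) hueq (fun k hk φ => ?_)
      · have h1 : deriv (fun t => u (t + q)) = fun t => deriv u (t + q) :=
          funext fun t => deriv_comp_add_const u q t
        rw [h1, deriv_comp_add_const, hueq]
      · have hnat : ∀ m : ℕ, m = 0 ∨ m ∈ resonances T A → ∀ φ,
            phaseCoeff T (fun t => u (t + q)) m φ = phaseCoeff T u m φ := fun m hm φ => by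
          by_cases hmS : m = 0 ∨ m ∈ S
          · refine phaseCoeff_shift_of_cos_eq_one hT hper ?_ φ
            rcases hmS with rfl | hmS
            · simp
            · exact_mod_cast hq m hmS
          · push Not at hmS
            have hzero : ∀ φ, phaseCoeff T u m φ = 0 := by
              by_contra! hex
              exact hmS.2 (Finset.mem_filter.2
                ⟨(Set.Finite.mem_toFinset _).2 (hm.resolve_left hmS.1), hex⟩)
            rw [phaseCoeff_shift hT hper, hzero, hzero]
        have hk' : k.natAbs = 0 ∨ k.natAbs ∈ resonances T A := hk.imp_left Int.natAbs_eq_zero.2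
        rcases k.natAbs_eq with h | h
        · rw [h]
          exact hnat _ hk' φ
        · rw [h, phaseCoeff_neg, phaseCoeff_neg]
          exact hnat _ hk' (-φ)
  have hSne : S.Nonempty := by
    by_contra hS
    obtain ⟨t₁, t₂, h12⟩ := hne
    have := (hshift (t₁ - t₂)).2 (fun k hk => absurd ⟨k, hk⟩ hS) t₂
    rw [add_sub_cancel] at this
    exact h12 this
  exact ⟨S, hSne, fun k hk => hSR k hk,
    isLeast_period_of_harmonics hT hSne (fun k hk => (hSR k hk).1) hshift⟩

/-- Minimal periods of solutions accumulating at a stationary solution (second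
conclusion of Theorem 5.9): if the constant solution `p₀` is not isolated among
`T`-periodic solutions of `ẍ = -∇V(x)`, then
`R = {k ≥ 1 : 4k²π²/T² ∈ σ(D²V(p₀))}` is nonempty and every non-constant
`T`-periodic solution close enough to `p₀` has minimal period `T/d`, where `d`
is the gcd of some nonempty subset of `R`. -/
theorem minimal_periods_near_nonisolated_stationary_solution
    (T : ℝ) (hT : 0 < T) (n : ℕ)
    (V : EuclideanSpace ℝ (Fin n) → ℝ) (hV : ContDiff ℝ 2 V)
    (hfin : {x : EuclideanSpace ℝ (Fin n) | gradient V x = 0}.Finite)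
    (p₀ : EuclideanSpace ℝ (Fin n)) (hp₀ : gradient V p₀ = 0)
    -- p₀ is not isolated among T-periodic solutions
    (hnoniso : ∀ δ > (0 : ℝ), ∃ u : ℝ → EuclideanSpace ℝ (Fin n),
      ContDiff ℝ 2 u ∧ (∀ t, u (t + T) = u t) ∧
      (∀ t, deriv (deriv u) t = -gradient V (u t)) ∧
      (∃ t, u t ≠ p₀) ∧ (∀ t, ‖u t - p₀‖ + ‖deriv u t‖ < δ)) :
    -- R is nonempty
    {k : ℕ | 1 ≤ k ∧ ∃ x : EuclideanSpace ℝ (Fin n), x ≠ 0 ∧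
        fderiv ℝ (gradient V) p₀ x =
          ((4 * (k : ℝ) ^ 2 * π ^ 2) / T ^ 2) • x}.Nonempty ∧
    -- every non-constant solution close enough to p₀ has minimal period T/d,
    -- d = gcd of a nonempty subset of R
    ∃ ε > (0 : ℝ), ∀ u : ℝ → EuclideanSpace ℝ (Fin n),
      ContDiff ℝ 2 u → (∀ t, u (t + T) = u t) →
      (∀ t, deriv (deriv u) t = -gradient V (u t)) →
      (∃ t₁ t₂, u t₁ ≠ u t₂) →
      (∀ t, ‖u t - p₀‖ + ‖deriv u t‖ < ε) →
      ∃ s : Finset ℕ, s.Nonempty ∧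
        (↑s ⊆ {k : ℕ | 1 ≤ k ∧ ∃ x : EuclideanSpace ℝ (Fin n), x ≠ 0 ∧
          fderiv ℝ (gradient V) p₀ x =
            ((4 * (k : ℝ) ^ 2 * π ^ 2) / T ^ 2) • x}) ∧
        IsLeast {q : ℝ | 0 < q ∧ ∀ t, u (t + q) = u t} (T / (s.gcd id : ℕ)) := by
  have hgrad : ContDiff ℝ 1 (gradient V) :=
    (InnerProductSpace.toDual ℝ _).symm.contDiff.comp (hV.fderiv_right le_rfl)
  obtain ⟨ε, hε, hmain⟩ := eventually_minimal_period hT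
    (hgrad.contDiffAt.hasStrictFDerivAt (x := p₀) one_ne_zero)
  have hclose : ∀ u : ℝ → EuclideanSpace ℝ (Fin n), ∀ δ, (∀ t, ‖u t - p₀‖ + ‖deriv u t‖ < δ) →
      ∀ t, ‖u t - p₀‖ < δ := fun u δ h t =>
    (le_add_of_nonneg_right (norm_nonneg _)).trans_lt (h t)
  refine ⟨?_, ε, hε, fun u h1 h2 h3 h4 h5 => hmain u h1 h2 h3 h4 (hclose u ε h5)⟩
  have hisol : ({x | gradient V x = 0} \ {p₀})ᶜ ∈ nhds p₀ :=
    (hfin.subset Set.sdiff_subset).isClosed.isOpen_compl.mem_nhds fun h => h.2 rfl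
  obtain ⟨r, hr, hball⟩ := Metric.mem_nhds_iff.1 hisol
  obtain ⟨u, hu, hper, hueq, ⟨t₀, ht₀⟩, hlt⟩ := hnoniso (min ε r) (lt_min hε hr)
  have hlt' := hclose u _ hlt
  have hne : ∃ t₁ t₂, u t₁ ≠ u t₂ := by
    by_contra! hconst
    have hu_const : u = fun _ => u t₀ := funext fun t => hconst t t₀
    have hcrit : gradient V (u t₀) = 0 := by
      have h := hueq t₀
      rw [hu_const] at h
      simpa using h.symm
    exact hball (mem_ball_iff_norm.2 ((hlt' t₀).trans_le (min_le_right _ _))) ⟨hcrit, ht₀⟩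
  obtain ⟨s, ⟨k, hk⟩, hsub, -⟩ :=
    hmain u hu hper hueq hne fun t => (hlt' t).trans_le (min_le_left _ _)
  exact ⟨k, hsub hk⟩
end

section
/- Critical points of the perturbed quadratic potential (Lemma 6.2): Let a > 0 and let B be a real symmetric n×n matrix such that every eigenvalue of B lying in the interval [−a^{−3/2}, 0) has multiplicity one. Define V : ℝⁿ → ℝ by V(x) = ½⟨Bx, x⟩ − (‖x‖² + a)^{−1/2}, so that ∇V(x) = Bx + (‖x‖² + a)^{−3/2}·x. Then the zero set (∇V)⁻¹(0) is finite; more precisely, ∇V(x) = 0 if and only if x = 0 or x = ±√((−λ)^{−2/3} − a)·v for some eigenvalue λ of B with −a^{−3/2} < λ < 0 and some unit eigenvector v of B corresponding to λ. -/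
open Real RealInnerProductSpace

theorem hasGradientAt_quadratic_sub_rpow {E : Type*} [NormedAddCommGroup E] [InnerProductSpace ℝ E]
    [CompleteSpace E] {a : ℝ} (ha : 0 < a) (B : E →L[ℝ] E)
    (hB : ∀ x y : E, ⟪B x, y⟫ = ⟪x, B y⟫) (x : E) :
    HasGradientAt (fun x : E => (1 / 2 : ℝ) * ⟪B x, x⟫ - (‖x‖ ^ 2 + a) ^ (-(1 : ℝ) / 2))
      (B x + ((‖x‖ ^ 2 + a) ^ (-(3 : ℝ) / 2)) • x) x := by
  have hpos : ‖x‖ ^ 2 + a ≠ 0 := by positivity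
  have h1 := ((B.hasFDerivAt (x := x)).inner ℝ (hasFDerivAt_id x)).const_mul (1 / 2 : ℝ)
  have h2 := (((hasFDerivAt_id x).norm_sq).add_const a).rpow_const (p := -(1 : ℝ) / 2)
    (Or.inl hpos)
  rw [hasGradientAt_iff_hasFDerivAt]
  refine (h1.sub h2).congr_fderiv ?_
  ext y
  have h3 : -(1 : ℝ) / 2 - 1 = -3 / 2 := by norm_num
  have h4 : ⟪B y, x⟫ = ⟪B x, y⟫ := by rw [hB, real_inner_comm]
  simp [h3, h4, fderivInnerCLM_apply]
  ring

theorem rpow_neg_three_halves_rpow_neg_two_thirds {t : ℝ} (ht : 0 ≤ t) :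
    (t ^ (-(3 : ℝ) / 2)) ^ (-(2 : ℝ) / 3) = t := by
  rw [← Real.rpow_mul ht]
  norm_num

theorem rpow_neg_two_thirds_rpow_neg_three_halves {t : ℝ} (ht : 0 ≤ t) :
    (t ^ (-(2 : ℝ) / 3)) ^ (-(3 : ℝ) / 2) = t := by
  rw [← Real.rpow_mul ht]
  norm_num

theorem eq_or_eq_neg_of_norm_eq_of_finrank_le_one {E : Type*} [NormedAddCommGroup E]
    [NormedSpace ℝ E] [FiniteDimensional ℝ E] {W : Submodule ℝ E}
    (hW : Module.finrank ℝ W ≤ 1) {x y : E} (hx : x ∈ W) (hy : y ∈ W) (hxy : ‖x‖ = ‖y‖) :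
    x = y ∨ x = -y := by
  obtain ⟨v, hv⟩ := finrank_le_one_iff.1 hW
  obtain ⟨c, hc⟩ := hv ⟨x, hx⟩
  obtain ⟨d, hd⟩ := hv ⟨y, hy⟩
  have hcx : c • (v : E) = x := congrArg Subtype.val hc
  have hdy : d • (v : E) = y := congrArg Subtype.val hd
  subst hcx hdy
  rw [norm_smul, norm_smul] at hxy
  rcases mul_eq_mul_right_iff.1 hxy with h | h
  · rcases abs_eq_abs.1 h with h | h
    · exact Or.inl (by rw [h])
    · exact Or.inr (by rw [h, neg_smul])
  · exact Or.inl (by simp [norm_eq_zero.1 h])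

theorem norm_eq_of_rpow_eq {E : Type*} [NormedAddCommGroup E] {a : ℝ} (ha : 0 < a) {x y : E}
    (h : (‖x‖ ^ 2 + a) ^ (-(3 : ℝ) / 2) = (‖y‖ ^ 2 + a) ^ (-(3 : ℝ) / 2)) : ‖x‖ = ‖y‖ := by
  have hx : 0 ≤ ‖x‖ ^ 2 + a := by positivity
  have hy : 0 ≤ ‖y‖ ^ 2 + a := by positivity
  have hsq : ‖x‖ ^ 2 + a = ‖y‖ ^ 2 + a := by
    rw [← rpow_neg_three_halves_rpow_neg_two_thirds hx, h,
      rpow_neg_three_halves_rpow_neg_two_thirds hy]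
  exact (sq_eq_sq₀ (norm_nonneg x) (norm_nonneg y)).1 (add_right_cancel hsq)

theorem finite_eigenvectors_of_rpow_eq {E : Type*} [NormedAddCommGroup E] [NormedSpace ℝ E]
    [FiniteDimensional ℝ E] {a : ℝ} (ha : 0 < a) (B : E →L[ℝ] E)
    (hmult : ∀ lam : ℝ, -(a ^ (-(3 : ℝ) / 2)) ≤ lam → lam < 0 →
      Module.finrank ℝ (LinearMap.ker ((B : E →ₗ[ℝ] E) - lam • LinearMap.id)) ≤ 1) (lam : ℝ) :
    {x : E | B x = lam • x ∧ lam = -((‖x‖ ^ 2 + a) ^ (-(3 : ℝ) / 2))}.Finite := by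
  rcases Set.eq_empty_or_nonempty
    {x : E | B x = lam • x ∧ lam = -((‖x‖ ^ 2 + a) ^ (-(3 : ℝ) / 2))} with h | ⟨y, hy, hlam⟩
  · rw [h]
    exact Set.finite_empty
  · refine (Set.toFinite {y, -y}).subset ?_
    rintro x ⟨hx, hlam'⟩
    have hneg : lam < 0 := by
      rw [hlam, neg_lt_zero]
      positivity
    have hle : -(a ^ (-(3 : ℝ) / 2)) ≤ lam := by
      rw [hlam, neg_le_neg_iff]
      exact Real.rpow_le_rpow_of_nonpos ha (le_add_of_nonneg_left (sq_nonneg _)) (by norm_num)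
    exact eq_or_eq_neg_of_norm_eq_of_finrank_le_one (hmult lam hle hneg)
      (by simp [hx]) (by simp [hy])
      (norm_eq_of_rpow_eq ha (neg_injective (hlam'.symm.trans hlam)))

theorem finite_zeros_add_rpow_smul {E : Type*} [NormedAddCommGroup E] [NormedSpace ℝ E]
    [FiniteDimensional ℝ E] {a : ℝ} (ha : 0 < a) (B : E →L[ℝ] E)
    (hmult : ∀ lam : ℝ, -(a ^ (-(3 : ℝ) / 2)) ≤ lam → lam < 0 →
      Module.finrank ℝ (LinearMap.ker ((B : E →ₗ[ℝ] E) - lam • LinearMap.id)) ≤ 1) :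
    {x : E | B x + ((‖x‖ ^ 2 + a) ^ (-(3 : ℝ) / 2)) • x = 0}.Finite := by
  have hfin : {lam : ℝ | Module.End.HasEigenvalue (B : E →ₗ[ℝ] E) lam}.Finite :=
    Module.End.finite_hasEigenvalue _
  refine ((hfin.biUnion fun lam _ => finite_eigenvectors_of_rpow_eq ha B hmult lam).union
    (Set.finite_singleton 0)).subset fun x hx => ?_
  by_cases h0 : x = 0
  · exact Or.inr h0
  · have hev : B x = (-((‖x‖ ^ 2 + a) ^ (-(3 : ℝ) / 2))) • x := by
      rw [neg_smul]
      exact eq_neg_of_add_eq_zero_left hx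
    left
    simp only [Set.mem_iUnion]
    exact ⟨_, Module.End.hasEigenvalue_of_hasEigenvector
      (x := x) ⟨Module.End.mem_eigenspace_iff.2 hev, h0⟩, hev, rfl⟩

theorem add_rpow_smul_eq_zero_of_eigenvector {E : Type*} [NormedAddCommGroup E] [NormedSpace ℝ E]
    {a : ℝ} (ha : 0 < a) (B : E →L[ℝ] E) {lam r : ℝ} {v : E}
    (hlam : -(a ^ (-(3 : ℝ) / 2)) < lam) (hneg : lam < 0) (hv : ‖v‖ = 1) (hBv : B v = lam • v)
    (hr : r ^ 2 = Real.sqrt ((-lam) ^ (-(2 : ℝ) / 3) - a) ^ 2) :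
    B (r • v) + ((‖r • v‖ ^ 2 + a) ^ (-(3 : ℝ) / 2)) • (r • v) = 0 := by
  have hlt : a < (-lam) ^ (-(2 : ℝ) / 3) := by
    have h := Real.rpow_lt_rpow_of_neg (x := -lam) (y := a ^ (-(3 : ℝ) / 2)) (z := -(2 : ℝ) / 3)
      (by linarith) (by linarith) (by norm_num)
    rwa [rpow_neg_three_halves_rpow_neg_two_thirds ha.le] at h
  rw [Real.sq_sqrt (by linarith)] at hr
  rw [norm_smul, hv, mul_one, Real.norm_eq_abs, sq_abs, hr, sub_add_cancel,
    rpow_neg_two_thirds_rpow_neg_three_halves (by linarith), map_smul, hBv, smul_comm r lam,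
    neg_smul, add_neg_cancel]

theorem exists_eigenvector_of_add_rpow_smul_eq_zero {E : Type*} [NormedAddCommGroup E]
    [NormedSpace ℝ E] {a : ℝ} (ha : 0 < a) (B : E →L[ℝ] E) {x : E} (h0 : x ≠ 0)
    (hx : B x + ((‖x‖ ^ 2 + a) ^ (-(3 : ℝ) / 2)) • x = 0) :
    ∃ (lam : ℝ) (v : E), -(a ^ (-(3 : ℝ) / 2)) < lam ∧ lam < 0 ∧ ‖v‖ = 1 ∧ B v = lam • v ∧
      x = Real.sqrt ((-lam) ^ (-(2 : ℝ) / 3) - a) • v := by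
  have hnx : 0 < ‖x‖ := norm_pos_iff.2 h0
  refine ⟨-((‖x‖ ^ 2 + a) ^ (-(3 : ℝ) / 2)), ‖x‖⁻¹ • x, ?_, ?_, ?_, ?_, ?_⟩
  · rw [neg_lt_neg_iff]
    exact Real.rpow_lt_rpow_of_neg ha (lt_add_of_pos_left a (by positivity)) (by norm_num)
  · rw [neg_lt_zero]
    positivity
  · rw [norm_smul, norm_inv, norm_norm, inv_mul_cancel₀ hnx.ne']
  · rw [map_smul, eq_neg_of_add_eq_zero_left hx, smul_comm, neg_smul]
  · rw [neg_neg, rpow_neg_three_halves_rpow_neg_two_thirds (by positivity), add_sub_cancel_right,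
      Real.sqrt_sq hnx.le, smul_inv_smul₀ hnx.ne']

/-- Critical points of the perturbed quadratic potential (Lemma 6.2). -/
theorem critical_points_perturbed_quadratic
    (n : ℕ) (a : ℝ) (ha : 0 < a)
    (B : EuclideanSpace ℝ (Fin n) →L[ℝ] EuclideanSpace ℝ (Fin n))
    (hBsym : ∀ x y : EuclideanSpace ℝ (Fin n), ⟪B x, y⟫ = ⟪x, B y⟫)
    -- every eigenvalue of B in [-a^{-3/2}, 0) has multiplicity one
    (hmult : ∀ lam : ℝ, -(a ^ (-(3 : ℝ) / 2)) ≤ lam → lam < 0 →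
      Module.finrank ℝ
        (LinearMap.ker ((B : EuclideanSpace ℝ (Fin n) →ₗ[ℝ] EuclideanSpace ℝ (Fin n))
          - lam • LinearMap.id)) ≤ 1)
    (V : EuclideanSpace ℝ (Fin n) → ℝ)
    (hVdef : ∀ x, V x = (1 / 2 : ℝ) * ⟪B x, x⟫ - (‖x‖ ^ 2 + a) ^ (-(1 : ℝ) / 2)) :
    -- ∇V(x) = Bx + (‖x‖² + a)^{-3/2} x
    (∀ x, gradient V x = B x + ((‖x‖ ^ 2 + a) ^ (-(3 : ℝ) / 2)) • x) ∧
    -- the zero set of ∇V is finite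
    {x : EuclideanSpace ℝ (Fin n) | gradient V x = 0}.Finite ∧
    -- and is described explicitly
    (∀ x : EuclideanSpace ℝ (Fin n), gradient V x = 0 ↔
      (x = 0 ∨ ∃ (lam : ℝ) (v : EuclideanSpace ℝ (Fin n)),
        -(a ^ (-(3 : ℝ) / 2)) < lam ∧ lam < 0 ∧ ‖v‖ = 1 ∧ B v = lam • v ∧
        (x = Real.sqrt ((-lam) ^ (-(2 : ℝ) / 3) - a) • v ∨
          x = -(Real.sqrt ((-lam) ^ (-(2 : ℝ) / 3) - a)) • v))) := by
  have hgrad : ∀ x, gradient V x = B x + ((‖x‖ ^ 2 + a) ^ (-(3 : ℝ) / 2)) • x := by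
    intro x
    rw [funext hVdef]
    exact (hasGradientAt_quadratic_sub_rpow ha B hBsym x).gradient
  simp only [hgrad]
  refine ⟨fun _ => trivial, finite_zeros_add_rpow_smul ha B hmult, fun x => ⟨fun hx => ?_, ?_⟩⟩
  · by_cases h0 : x = 0
    · exact Or.inl h0
    · obtain ⟨lam, v, h1, h2, h3, h4, h5⟩ :=
        exists_eigenvector_of_add_rpow_smul_eq_zero ha B h0 hx
      exact Or.inr ⟨lam, v, h1, h2, h3, h4, Or.inl h5⟩
  · rintro (rfl | ⟨lam, v, h1, h2, h3, h4, rfl | rfl⟩)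
    · simp
    · exact add_rpow_smul_eq_zero_of_eigenvector ha B h1 h2 h3 h4 rfl
    · exact add_rpow_smul_eq_zero_of_eigenvector ha B h1 h2 h3 h4 (neg_sq _)
end

section
/- Triviality of the critical set in the nonresonant range (Lemma 6.3): Let a > 0 and let B be a real symmetric n×n matrix having no eigenvalue in the interval [−a^{−3/2}, 0). Define V : ℝⁿ → ℝ by V(x) = ½⟨Bx, x⟩ − (‖x‖² + a)^{−1/2}, so that ∇V(x) = Bx + (‖x‖² + a)^{−3/2}·x. Then ∇V(x) = 0 if and only if x = 0. -/
open Real RealInnerProductSpace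

/-- The gradient of `½⟨Bx, x⟩ - (‖x‖² + a)^{-1/2}` for a symmetric operator `B` and `a > 0`. -/
theorem hasGradientAt_half_inner_sub_rpow {E : Type*} [NormedAddCommGroup E]
    [InnerProductSpace ℝ E] [CompleteSpace E] {a : ℝ} (ha : 0 < a) (B : E →L[ℝ] E)
    (hB : ∀ x y : E, ⟪B x, y⟫ = ⟪x, B y⟫) (x : E) :
    HasGradientAt
      (fun x : E => (1 / 2 : ℝ) * ⟪B x, x⟫ - (‖x‖ ^ 2 + a) ^ (-(1 : ℝ) / 2))
      (B x + (‖x‖ ^ 2 + a) ^ (-(3 : ℝ) / 2) • x) x := by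
  rw [hasGradientAt_iff_hasFDerivAt]
  have hpos : ‖x‖ ^ 2 + a ≠ 0 := by positivity
  have hquad := (B.hasFDerivAt (x := x)).inner ℝ (hasFDerivAt_id x)
  have hpow := ((hasStrictFDerivAt_norm_sq x).hasFDerivAt.add_const a).rpow_const
    (p := -(1 : ℝ) / 2) (Or.inl hpos)
  refine ((hquad.const_mul (1 / 2 : ℝ)).sub hpow).congr_fderiv ?_
  ext y
  have hexp : -(1 : ℝ) / 2 - 1 = -(3 : ℝ) / 2 := by norm_num
  have hsymm : ⟪B y, x⟫ = ⟪B x, y⟫ := by rw [hB, real_inner_comm, hB, real_inner_comm, hB]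
  simp [hexp, hsymm, fderivInnerCLM_apply]
  ring

/-- Triviality of the critical set in the nonresonant range (Lemma 6.3): if `B`
has no eigenvalue in `[-a^{-3/2}, 0)`, then the only critical point of
`V(x) = ½⟨Bx,x⟩ - (‖x‖² + a)^{-1/2}` is the origin. -/
theorem critical_set_trivial_nonresonant
    (n : ℕ) (a : ℝ) (ha : 0 < a)
    (B : EuclideanSpace ℝ (Fin n) →L[ℝ] EuclideanSpace ℝ (Fin n))
    (hBsym : ∀ x y : EuclideanSpace ℝ (Fin n), ⟪B x, y⟫ = ⟪x, B y⟫)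
    -- B has no eigenvalue in [-a^{-3/2}, 0)
    (hnoeig : ∀ lam : ℝ, -(a ^ (-(3 : ℝ) / 2)) ≤ lam → lam < 0 →
      ∀ x : EuclideanSpace ℝ (Fin n), B x = lam • x → x = 0)
    (V : EuclideanSpace ℝ (Fin n) → ℝ)
    (hVdef : ∀ x, V x = (1 / 2 : ℝ) * ⟪B x, x⟫ - (‖x‖ ^ 2 + a) ^ (-(1 : ℝ) / 2)) :
    ∀ x : EuclideanSpace ℝ (Fin n), gradient V x = 0 ↔ x = 0 := by
  intro x
  have hgrad : gradient V x = B x + (‖x‖ ^ 2 + a) ^ (-(3 : ℝ) / 2) • x := by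
    rw [funext hVdef]
    exact (hasGradientAt_half_inner_sub_rpow ha B hBsym x).gradient
  rw [hgrad]
  refine ⟨fun h => ?_, fun h => by simp [h]⟩
  refine hnoeig (-((‖x‖ ^ 2 + a) ^ (-(3 : ℝ) / 2))) (neg_le_neg ?_) ?_ x ?_
  · exact Real.rpow_le_rpow_of_nonpos ha (by linarith [sq_nonneg ‖x‖]) (by norm_num)
  · exact neg_neg_of_pos (Real.rpow_pos_of_pos (by positivity) _)
  · rw [neg_smul]
    exact eq_neg_of_add_eq_zero_left h
end

section
/- Example 7.1: Define V : ℝ⁴ → ℝ by V(x) = ½·((7/2)x₁² − 2x₂² − (1/(2√2))x₄²) − (‖x‖² + 1)^{−1/2} (i.e. V(x) = ½⟨Bx,x⟩ − (‖x‖²+1)^{−1/2} with B = diag(7/2, −2, 0, −1/(2√2))). Then the Newtonian system ẍ = −∇V(x) has at least one non-stationary 2π-periodic solution. -/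
/-- An autonomous scalar equation `dθ/dt = g θ` with a positive, bounded, `T`-periodic right-hand side
has a global solution advancing by `T` in the time `∫₀ᵀ 1/g`. -/
theorem exists_rotating_solution {g : ℝ → ℝ} {T M : ℝ} (hg : Continuous g)
    (hpos : ∀ x, 0 < g x) (hM : ∀ x, g x ≤ M) (hper : Function.Periodic g T) :
    ∃ θ : ℝ → ℝ, Function.Surjective θ ∧ (∀ t, HasDerivAt θ (g (θ t)) t) ∧
      ∀ t, θ (t + ∫ x in (0 : ℝ)..T, (g x)⁻¹) = θ t + T := by
  have hM0 : 0 < M := (hpos 0).trans_le (hM 0)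
  have hc : Continuous fun x => (g x)⁻¹ := hg.inv₀ fun x => (hpos x).ne'
  set τ : ℝ → ℝ := fun y => ∫ x in (0 : ℝ)..y, (g x)⁻¹ with hτ
  have hd : ∀ y, HasDerivAt τ (g y)⁻¹ y := fun y =>
    intervalIntegral.integral_hasDerivAt_right (hc.intervalIntegrable _ _)
      (hc.stronglyMeasurableAtFilter _ _) hc.continuousAt
  have hτc : Continuous τ := continuous_iff_continuousAt.2 fun y => (hd y).continuousAt
  have hmono : StrictMono τ := strictMono_of_deriv_pos fun y => by
    rw [(hd y).deriv]
    exact inv_pos.2 (hpos y)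
  have hlow : Monotone fun y => τ y - M⁻¹ * y := by
    have hd' : ∀ y, HasDerivAt (fun y => τ y - M⁻¹ * y) ((g y)⁻¹ - M⁻¹ * 1) y := fun y =>
      (hd y).sub ((hasDerivAt_id y).const_mul _)
    refine monotone_of_deriv_nonneg (fun y => (hd' y).differentiableAt) fun y => ?_
    rw [(hd' y).deriv, mul_one, sub_nonneg]
    exact inv_anti₀ (hpos y) (hM y)
  have hτ0 : τ 0 = 0 := intervalIntegral.integral_same
  have htop : Filter.Tendsto τ Filter.atTop Filter.atTop := by
    refine Filter.tendsto_atTop_mono' _ ?_ (Filter.tendsto_id.const_mul_atTop (inv_pos.2 hM0))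
    filter_upwards [Filter.eventually_ge_atTop 0] with y hy
    have := hlow hy
    simp only [hτ0, id] at this ⊢
    linarith
  have hbot : Filter.Tendsto τ Filter.atBot Filter.atBot := by
    refine Filter.tendsto_atBot_mono' _ ?_ (Filter.tendsto_id.const_mul_atBot (inv_pos.2 hM0))
    filter_upwards [Filter.eventually_le_atBot 0] with y hy
    have := hlow hy
    simp only [hτ0, id] at this ⊢
    linarith
  let e : ℝ ≃o ℝ := hmono.orderIsoOfSurjective τ (hτc.surjective htop hbot)
  have he : ∀ t, τ (e.symm t) = t := fun t => e.apply_symm_apply t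
  refine ⟨e.symm, e.symm.surjective, fun t => ?_, fun t => hmono.injective ?_⟩
  · have := (hd (e.symm t)).of_local_left_inverse e.symm.continuous.continuousAt
      (inv_pos.2 (hpos _)).ne' (Filter.Eventually.of_forall he)
    rwa [inv_inv] at this
  · have hp : Function.Periodic (fun x => (g x)⁻¹) T := fun x => by simp only [hper x]
    have := hp.intervalIntegral_add_eq_add 0 (e.symm t) fun a b => hc.intervalIntegrable a b
    rw [zero_add] at this
    rw [he, hτ]
    change _ = ∫ x in (0 : ℝ)..e.symm t + T, (g x)⁻¹
    rw [this]
    congr 1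
    exact (he t).symm

/-- The squared angular speed of the phase `θ` for the solution `a sin θ` of
`d²w/dt² = -(7/2 + (1 + w²)^{-3/2}) w` with amplitude `a`. -/
noncomputable def phaseSpeedSq (a x : ℝ) : ℝ :=
  7 / 2 + 2 / (√(1 + a ^ 2) * √(1 + (a * Real.sin x) ^ 2) *
    (√(1 + a ^ 2) + √(1 + (a * Real.sin x) ^ 2)))

theorem one_le_sqrt_one_add_sq (b : ℝ) : 1 ≤ √(1 + b ^ 2) :=
  Real.one_le_sqrt.2 (by nlinarith [sq_nonneg b])

theorem phaseSpeedSq_gt (a x : ℝ) : 7 / 2 < phaseSpeedSq a x := by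
  have hP := one_le_sqrt_one_add_sq a
  have hQ := one_le_sqrt_one_add_sq (a * Real.sin x)
  unfold phaseSpeedSq
  have : 0 < 2 / (√(1 + a ^ 2) * √(1 + (a * Real.sin x) ^ 2) *
    (√(1 + a ^ 2) + √(1 + (a * Real.sin x) ^ 2))) := by positivity
  linarith

theorem phaseSpeedSq_le (a x : ℝ) : phaseSpeedSq a x ≤ 9 / 2 := by
  have hP := one_le_sqrt_one_add_sq a
  have hQ := one_le_sqrt_one_add_sq (a * Real.sin x)
  unfold phaseSpeedSq
  have h1 := one_le_mul_of_one_le_of_one_le hP hQ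
  have : 2 / (√(1 + a ^ 2) * √(1 + (a * Real.sin x) ^ 2) *
    (√(1 + a ^ 2) + √(1 + (a * Real.sin x) ^ 2))) ≤ 1 := by
    rw [div_le_one (by positivity)]
    nlinarith
  linarith

theorem phaseSpeedSq_zero (x : ℝ) : phaseSpeedSq 0 x = 9 / 2 := by
  norm_num [phaseSpeedSq]

theorem phaseSpeedSq_sqrt_three_lt (x : ℝ) : phaseSpeedSq √3 x < 4 := by
  have hQ := one_le_sqrt_one_add_sq (√3 * Real.sin x)
  unfold phaseSpeedSq
  have hP : √(1 + √3 ^ 2) = 2 := by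
    rw [Real.sq_sqrt (by norm_num), show (1 + 3 : ℝ) = 2 ^ 2 by norm_num,
      Real.sqrt_sq (by norm_num)]
  rw [hP]
  have : 2 / (2 * √(1 + (√3 * Real.sin x) ^ 2) * (2 + √(1 + (√3 * Real.sin x) ^ 2))) < 1 / 2 := by
    rw [div_lt_iff₀ (by positivity)]
    nlinarith
  linarith

theorem continuous_phaseSpeedSq : Continuous fun p : ℝ × ℝ => phaseSpeedSq p.1 p.2 := by
  unfold phaseSpeedSq
  refine continuous_const.add (continuous_const.div (by fun_prop) fun p => ?_)
  have hP := one_le_sqrt_one_add_sq p.1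
  have hQ := one_le_sqrt_one_add_sq (p.1 * Real.sin p.2)
  positivity

theorem hasDerivAt_cos_mul_sqrt_phaseSpeedSq (a x : ℝ) :
    HasDerivAt (fun y => a * Real.cos y * √(phaseSpeedSq a y))
      (-(7 / 2 + (√(1 + (a * Real.sin x) ^ 2) ^ 3)⁻¹) * (a * Real.sin x) /
        √(phaseSpeedSq a x)) x := by
  have hP := one_le_sqrt_one_add_sq a
  have hQ := one_le_sqrt_one_add_sq (a * Real.sin x)
  have hP2 : √(1 + a ^ 2) ^ 2 = 1 + a ^ 2 := Real.sq_sqrt (by positivity)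
  have hQ2 : √(1 + (a * Real.sin x) ^ 2) ^ 2 = 1 + (a * Real.sin x) ^ 2 :=
    Real.sq_sqrt (by positivity)
  have hh : 0 < phaseSpeedSq a x := by linarith [phaseSpeedSq_gt a x]
  have hg : 0 < √(phaseSpeedSq a x) := Real.sqrt_pos.2 hh
  have hg2 : √(phaseSpeedSq a x) ^ 2 = phaseSpeedSq a x := Real.sq_sqrt hh.le
  have hdQ : HasDerivAt (fun y => √(1 + (a * Real.sin y) ^ 2))
      (a ^ 2 * Real.sin x * Real.cos x / √(1 + (a * Real.sin x) ^ 2)) x := by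
    have h1 : HasDerivAt (fun y => 1 + (a * Real.sin y) ^ 2)
        (2 * (a * Real.sin x) * (a * Real.cos x)) x := by
      simpa using (((Real.hasDerivAt_sin x).const_mul a).pow 2).const_add 1
    refine (h1.sqrt (by positivity)).congr_deriv ?_
    field_simp
  set P := √(1 + a ^ 2) with hPdef
  have hdh : HasDerivAt (phaseSpeedSq a)
      (-2 * (P + 2 * √(1 + (a * Real.sin x) ^ 2)) /
        (P * √(1 + (a * Real.sin x) ^ 2) ^ 2 * (P + √(1 + (a * Real.sin x) ^ 2)) ^ 2) *
        (a ^ 2 * Real.sin x * Real.cos x / √(1 + (a * Real.sin x) ^ 2))) x := by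
    have h1 := (((hasDerivAt_const x (2 : ℝ)).div ((hdQ.const_mul P).mul (hdQ.const_add P))
      (by simp only [Pi.mul_apply]; positivity)).const_add (7 / 2))
    refine h1.congr_deriv ?_
    simp only [Pi.mul_apply]
    generalize √(1 + (a * Real.sin x) ^ 2) = Q at *
    field_simp
    ring
  have hcos : a ^ 2 * Real.cos x ^ 2 = P ^ 2 - √(1 + (a * Real.sin x) ^ 2) ^ 2 := by
    rw [hP2, hQ2]
    linear_combination a ^ 2 * Real.sin_sq_add_cos_sq x
  refine (((Real.hasDerivAt_cos x).const_mul a).mul (hdh.sqrt hh.ne')).congr_deriv ?_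
  have hval : phaseSpeedSq a x = 7 / 2 + 2 / (P * √(1 + (a * Real.sin x) ^ 2) *
    (P + √(1 + (a * Real.sin x) ^ 2))) := rfl
  generalize √(phaseSpeedSq a x) = g at *
  rw [hval] at hg2
  generalize √(1 + (a * Real.sin x) ^ 2) = Q at *
  have key : -(7 / 2 + (Q ^ 3)⁻¹) * (a * Real.sin x) =
      -(a * Real.sin x) * (7 / 2 + 2 / (P * Q * (P + Q))) -
      a * Real.sin x * (P ^ 2 - Q ^ 2) * (P + 2 * Q) / (P * Q ^ 3 * (P + Q) ^ 2) := by
    field_simp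
    ring
  rw [key, ← hg2, ← hcos]
  field_simp
  ring

theorem exists_amplitude : ∃ a : ℝ, a ≠ 0 ∧
    ∫ x in (0 : ℝ)..4 * Real.pi, (√(phaseSpeedSq a x))⁻¹ = 2 * Real.pi := by
  have hpos : ∀ a x, 0 < √(phaseSpeedSq a x) := fun a x =>
    Real.sqrt_pos.2 (by linarith [phaseSpeedSq_gt a x])
  have hc : Continuous fun p : ℝ × ℝ => (√(phaseSpeedSq p.1 p.2))⁻¹ :=
    continuous_phaseSpeedSq.sqrt.inv₀ fun p => (hpos _ _).ne'
  have hF : Continuous fun a => ∫ x in (0 : ℝ)..4 * Real.pi, (√(phaseSpeedSq a x))⁻¹ :=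
    intervalIntegral.continuous_parametric_intervalIntegral_of_continuous' hc _ _
  have hpi : (0 : ℝ) < 4 * Real.pi := by positivity
  have h2 : (2 : ℝ) = √4 := by
    rw [show (4 : ℝ) = 2 ^ 2 by norm_num, Real.sqrt_sq (by norm_num)]
  have h0 : ∫ x in (0 : ℝ)..4 * Real.pi, (√(phaseSpeedSq 0 x))⁻¹ < 2 * Real.pi := by
    simp only [phaseSpeedSq_zero, intervalIntegral.integral_const, sub_zero, smul_eq_mul]
    have h3 : (2 : ℝ) < √(9 / 2) := by
      rw [h2]
      exact Real.sqrt_lt_sqrt (by norm_num) (by norm_num)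
    have h4 : (√(9 / 2 : ℝ))⁻¹ < 2⁻¹ := inv_strictAnti₀ (by norm_num) h3
    nlinarith
  have h1 : 2 * Real.pi ≤ ∫ x in (0 : ℝ)..4 * Real.pi, (√(phaseSpeedSq √3 x))⁻¹ := by
    have h3 : ∫ _ in (0 : ℝ)..4 * Real.pi, (2 : ℝ)⁻¹ = 2 * Real.pi := by
      rw [intervalIntegral.integral_const, smul_eq_mul]
      ring
    rw [← h3]
    refine intervalIntegral.integral_mono_on hpi.le (by simp)
      ((hc.comp (by fun_prop : Continuous fun x : ℝ => (√3, x))).intervalIntegrable _ _)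
      fun x _ => inv_anti₀ (hpos _ _) ?_
    rw [h2]
    exact Real.sqrt_le_sqrt (phaseSpeedSq_sqrt_three_lt x).le
  obtain ⟨a, -, ha⟩ := intermediate_value_Icc (Real.sqrt_nonneg 3) hF.continuousOn ⟨h0.le, h1⟩
  refine ⟨a, ?_, ha⟩
  rintro rfl
  exact h0.ne ha

theorem exists_periodic_solution_scalar : ∃ w v : ℝ → ℝ, (∀ t, HasDerivAt w (v t) t) ∧
    (∀ t, HasDerivAt v (-(7 / 2 + (√(1 + w t ^ 2) ^ 3)⁻¹) * w t) t) ∧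
    (∀ t, w (t + 2 * Real.pi) = w t) ∧ ∃ s t, w s ≠ w t := by
  obtain ⟨a, ha0, ha⟩ := exists_amplitude
  have hpos : ∀ x, 0 < √(phaseSpeedSq a x) := fun x =>
    Real.sqrt_pos.2 (by linarith [phaseSpeedSq_gt a x])
  obtain ⟨θ, hsurj, hθ, hper⟩ := exists_rotating_solution (T := 4 * Real.pi)
    (g := fun x => √(phaseSpeedSq a x))
    (continuous_phaseSpeedSq.comp (by fun_prop : Continuous fun x : ℝ => (a, x))).sqrt hpos
    (fun x => Real.sqrt_le_sqrt (phaseSpeedSq_le a x)) fun x => by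
      have : Real.sin (x + 4 * Real.pi) = Real.sin x := by
        rw [show x + 4 * Real.pi = x + 2 * Real.pi + 2 * Real.pi by ring,
          Real.sin_add_two_pi, Real.sin_add_two_pi]
      simp only [phaseSpeedSq, this]
  rw [ha] at hper
  refine ⟨fun t => a * Real.sin (θ t), fun t => a * Real.cos (θ t) * √(phaseSpeedSq a (θ t)),
    fun t => ?_, fun t => ?_, fun t => ?_, ?_⟩
  · exact ((hθ t).sin.const_mul a).congr_deriv (by ring)
  · refine ((hasDerivAt_cos_mul_sqrt_phaseSpeedSq a (θ t)).comp t (hθ t)).congr_deriv ?_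
    rw [div_mul_cancel₀ _ (hpos _).ne']
  · simp only [hper]
    rw [show θ t + 4 * Real.pi = θ t + 2 * Real.pi + 2 * Real.pi by ring,
      Real.sin_add_two_pi, Real.sin_add_two_pi]
  · obtain ⟨s, hs⟩ := hsurj 0
    obtain ⟨t, ht⟩ := hsurj (Real.pi / 2)
    exact ⟨s, t, by simpa [hs, ht] using ha0.symm⟩

theorem hasGradientAt_quadratic_sub_rpow_single (b : ℝ) (w : ℝ) :
    HasGradientAt (fun x : EuclideanSpace ℝ (Fin 4) =>
      (1 / 2 : ℝ) * ((7 / 2) * (x 0) ^ 2 - 2 * (x 1) ^ 2 - b * (x 3) ^ 2)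
        - (‖x‖ ^ 2 + 1) ^ (-(1 : ℝ) / 2))
      (EuclideanSpace.single 0 ((7 / 2 + (√(1 + w ^ 2) ^ 3)⁻¹) * w))
      (EuclideanSpace.single 0 w) := by
  rw [hasGradientAt_iff_hasFDerivAt]
  set p : EuclideanSpace ℝ (Fin 4) := EuclideanSpace.single 0 w with hp
  have hproj : ∀ i : Fin 4, HasFDerivAt (fun x : EuclideanSpace ℝ (Fin 4) => x i)
      (EuclideanSpace.proj i : EuclideanSpace ℝ (Fin 4) →L[ℝ] ℝ) p := fun i =>
    (EuclideanSpace.proj i : EuclideanSpace ℝ (Fin 4) →L[ℝ] ℝ).hasFDerivAt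
  have hnorm : HasFDerivAt (fun x : EuclideanSpace ℝ (Fin 4) => ‖x‖ ^ 2 + 1)
      (2 • innerSL ℝ p) p := ((hasStrictFDerivAt_norm_sq p).hasFDerivAt).add_const 1
  have hne : ‖p‖ ^ 2 + 1 ≠ 0 := by positivity
  have h := ((((((hproj 0).pow 2).const_mul (7 / 2)).sub (((hproj 1).pow 2).const_mul 2)).sub
    (((hproj 3).pow 2).const_mul b)).const_mul (1 / 2)).sub
      (hnorm.rpow_const (p := -(1 : ℝ) / 2) (Or.inl hne))
  have hpow : (w ^ 2 + 1) ^ (-(1 : ℝ) / 2 - 1) = (√(1 + w ^ 2) ^ 3)⁻¹ := by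
    rw [Real.sqrt_eq_rpow, ← Real.rpow_mul_natCast (by positivity),
      ← Real.rpow_neg (by positivity), add_comm]
    norm_num
  refine h.congr_fderiv ?_
  ext y
  simp [hp, hpow, EuclideanSpace.inner_single_left]
  ring

open Real

/-- Example 7.1: for
`V(x) = ½((7/2)x₁² - 2x₂² - (1/(2√2))x₄²) - (‖x‖² + 1)^{-1/2}` on `ℝ⁴`, the
system `ẍ = -∇V(x)` has a non-stationary `2π`-periodic solution. -/
theorem example_7_1
    (V : EuclideanSpace ℝ (Fin 4) → ℝ)
    (hVdef : ∀ x : EuclideanSpace ℝ (Fin 4),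
      V x = (1 / 2 : ℝ) * ((7 / 2) * (x 0) ^ 2 - 2 * (x 1) ^ 2
          - (1 / (2 * Real.sqrt 2)) * (x 3) ^ 2)
        - (‖x‖ ^ 2 + 1) ^ (-(1 : ℝ) / 2)) :
    ∃ u : ℝ → EuclideanSpace ℝ (Fin 4),
      ContDiff ℝ 2 u ∧ (∀ t, u (t + 2 * π) = u t) ∧
      (∀ t, deriv (deriv u) t = -gradient V (u t)) ∧
      ¬(∃ c : EuclideanSpace ℝ (Fin 4), ∀ t, u t = c) := by
  obtain ⟨w, v, hw, hv, hper, s, t, hst⟩ := exists_periodic_solution_scalar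
  obtain rfl : V = _ := funext hVdef
  let e : EuclideanSpace ℝ (Fin 4) := EuclideanSpace.single 0 1
  have he : ∀ r : ℝ, r • e = EuclideanSpace.single 0 r := fun r => by
    ext i
    simp [e]
  have hu : deriv (fun t => w t • e) = fun t => v t • e :=
    funext fun t => ((hw t).smul_const e).deriv
  have hwc : Continuous w := continuous_iff_continuousAt.2 fun t => (hw t).continuousAt
  have hv1 : ContDiff ℝ 1 v := by
    refine contDiff_one_iff_deriv.2 ⟨fun t => (hv t).differentiableAt, ?_⟩
    rw [funext fun t => (hv t).deriv]
    refine (continuous_const.add (Continuous.inv₀ (by fun_prop) fun t => ?_)).neg.mul hwc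
    have := one_le_sqrt_one_add_sq (w t)
    positivity
  have hw2 : ContDiff ℝ 2 w := by
    rw [show (2 : WithTop ℕ∞) = 1 + 1 by norm_num, contDiff_succ_iff_deriv]
    refine ⟨fun t => (hw t).differentiableAt, by simp, ?_⟩
    rwa [funext fun t => (hw t).deriv]
  refine ⟨fun t => w t • e, hw2.smul contDiff_const, fun t => by simp only [hper], fun t => ?_, ?_⟩
  · rw [hu, ((hv t).smul_const e).deriv]
    simp only [he]
    rw [(hasGradientAt_quadratic_sub_rpow_single _ (w t)).gradient, ← he, ← he, ← neg_smul, neg_mul]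
  · rintro ⟨c, hc⟩
    refine hst ?_
    have := congrArg (fun x : EuclideanSpace ℝ (Fin 4) => x 0) ((hc s).trans (hc t).symm)
    simpa [he] using this
end

section
/- Periodic solutions of the circular Sitnikov problem (Example 7.3): For every T > π/√2, the scalar equation ẍ = −x/(x² + 1/4)^{3/2} (the Newtonian system with potential V(x) = −(x² + 1/4)^{−1/2}) has at least one non-constant T-periodic solution, i.e. there exists a non-constant C² function u : ℝ → ℝ with u(t + T) = u(t) and u''(t) = −u(t)/(u(t)² + 1/4)^{3/2} for all t ∈ ℝ. -/
open Real

/-- A real function whose derivative is bounded below by a positive constant has a differentiable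
global inverse. -/
lemma exists_global_inverse_of_hasDerivAt {f f' : ℝ → ℝ} {c : ℝ} (hc : 0 < c)
    (hf : ∀ x, HasDerivAt f (f' x) x) (hf' : ∀ x, c ≤ f' x) :
    ∃ g : ℝ → ℝ, (∀ t, f (g t) = t) ∧ (∀ x, g (f x) = x) ∧
      ∀ t, HasDerivAt g (f' (g t))⁻¹ t := by
  have hmono : StrictMono f := strictMono_of_hasDerivAt_pos hf fun x => hc.trans_le (hf' x)
  have hcont : Continuous f := continuous_iff_continuousAt.2 fun x => (hf x).continuousAt
  have hlin : Monotone fun x => f x - c * x := by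
    refine monotone_of_hasDerivAt_nonneg (f' := fun x => f' x - c * 1) (fun x => ?_) fun x => ?_
    · exact (hf x).sub ((hasDerivAt_id x).const_mul c)
    · simpa using hf' x
  have hsurj : Function.Surjective f := by
    refine hcont.surjective ?_ ?_
    · refine Filter.tendsto_atTop_mono' _ ?_
        (Filter.tendsto_atTop_add_const_right _ (f 0) (Filter.tendsto_id.const_mul_atTop hc))
      filter_upwards [Filter.eventually_ge_atTop 0] with x hx
      have := hlin hx
      simp only [id] at this ⊢
      linarith
    · refine Filter.tendsto_atBot_mono' _ ?_
        (Filter.tendsto_atBot_add_const_right _ (f 0) (Filter.tendsto_id.const_mul_atBot hc))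
      filter_upwards [Filter.eventually_le_atBot 0] with x hx
      have := hlin hx
      simp only [id] at this ⊢
      linarith
  let e := hmono.orderIsoOfSurjective f hsurj
  have hright : ∀ t, f (e.symm t) = t := e.apply_symm_apply
  refine ⟨e.symm, hright, e.symm_apply_apply, fun t => ?_⟩
  exact (hf _).of_local_left_inverse e.symm.continuous.continuousAt
    (hc.trans_le (hf' _)).ne' (Filter.Eventually.of_forall hright)

/-- The position `x`, of the same sign as `w`, whose potential energy above the equilibrium is
`w² / 2`, i.e. the odd solution of `w² / 2 = 2 - (x² + 1/4)^{-1/2}` for `|w| < 2`. -/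
noncomputable def sitnikovPosition (w : ℝ) : ℝ := w * √(8 - w ^ 2) / (2 * (4 - w ^ 2))

/-- The derivative of `sitnikovPosition` on `|w| < 2`. -/
noncomputable def sitnikovTimeDensity (w : ℝ) : ℝ := 16 / (√(8 - w ^ 2) * (4 - w ^ 2) ^ 2)

lemma hasDerivAt_sitnikovPosition {w : ℝ} (hw : w ^ 2 < 4) :
    HasDerivAt sitnikovPosition (sitnikovTimeDensity w) w := by
  have h8 : 0 < 8 - w ^ 2 := by linarith
  have h4 : 0 < 4 - w ^ 2 := by linarith
  have hs : 0 < √(8 - w ^ 2) := sqrt_pos.2 h8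
  have hsq : √(8 - w ^ 2) ^ 2 = 8 - w ^ 2 := sq_sqrt h8.le
  have hp : HasDerivAt (fun w : ℝ => w ^ 2) (2 * w) w := by simpa using hasDerivAt_pow 2 w
  have hd := ((hasDerivAt_id w).mul ((hp.const_sub 8).sqrt h8.ne')).div
    ((hp.const_sub 4).const_mul 2) (by positivity)
  refine hd.congr_deriv ?_
  simp only [sitnikovTimeDensity, id, Pi.mul_apply]
  set s := √(8 - w ^ 2)
  have hw2 : w ^ 2 = 8 - s ^ 2 := by linarith
  field_simp
  ring_nf
  rw [show w ^ 4 = (w ^ 2) ^ 2 by ring, hw2]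
  ring

lemma sitnikovTimeDensity_pos {w : ℝ} (hw : w ^ 2 < 4) : 0 < sitnikovTimeDensity w := by
  have h8 : 0 < √(8 - w ^ 2) := sqrt_pos.2 (by linarith)
  have h4 : 0 < 4 - w ^ 2 := by linarith
  unfold sitnikovTimeDensity
  positivity

lemma div_sq_le_sitnikovTimeDensity {w b : ℝ} (hw : w ^ 2 < 4) (hb : 4 - w ^ 2 ≤ b) :
    5 / b ^ 2 ≤ sitnikovTimeDensity w := by
  have h8 : 0 < √(8 - w ^ 2) := sqrt_pos.2 (by linarith)
  have h3 : √(8 - w ^ 2) ≤ 3 := sqrt_le_iff.2 ⟨by norm_num, by nlinarith⟩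
  have h4 : 0 < 4 - w ^ 2 := by linarith
  have hsq : (4 - w ^ 2) ^ 2 ≤ b ^ 2 := pow_le_pow_left₀ h4.le hb 2
  unfold sitnikovTimeDensity
  rw [div_le_div_iff₀ (by nlinarith) (by positivity)]
  nlinarith [mul_le_mul h3 hsq (by positivity) (by norm_num)]

lemma continuousOn_sitnikovTimeDensity :
    ContinuousOn sitnikovTimeDensity {w | w ^ 2 < 4} := by
  refine ContinuousOn.div (by fun_prop) (by fun_prop) fun w (hw : w ^ 2 < 4) => ?_
  have h8 : 0 < √(8 - w ^ 2) := sqrt_pos.2 (by linarith)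
  have h4 : 0 < 4 - w ^ 2 := by linarith
  positivity

lemma sitnikovPosition_force {w : ℝ} (hw : w ^ 2 < 4) :
    -sitnikovPosition w / (sitnikovPosition w ^ 2 + 1 / 4) ^ ((3 : ℝ) / 2) =
      -w * (sitnikovTimeDensity w)⁻¹ := by
  have h8 : 0 < 8 - w ^ 2 := by linarith
  have h4 : 0 < 4 - w ^ 2 := by linarith
  have hs : 0 < √(8 - w ^ 2) := sqrt_pos.2 h8
  have hsum : sitnikovPosition w ^ 2 + 1 / 4 = (2 / (4 - w ^ 2)) ^ 2 := by
    rw [sitnikovPosition, div_pow, mul_pow, sq_sqrt h8.le]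
    field_simp
    ring
  have hpow : (sitnikovPosition w ^ 2 + 1 / 4) ^ ((3 : ℝ) / 2) = (2 / (4 - w ^ 2)) ^ 3 := by
    rw [hsum, ← rpow_natCast, ← rpow_mul (by positivity), ← rpow_natCast]
    norm_num
  rw [hpow, sitnikovPosition, sitnikovTimeDensity]
  field_simp
  norm_num

lemma sq_mul_sin_lt {v : ℝ} (hv : v ^ 2 < 4) (s : ℝ) : (v * sin s) ^ 2 < 4 := by
  rw [mul_pow]
  nlinarith [mul_le_mul_of_nonneg_left (sin_sq_le_one s) (sq_nonneg v)]

lemma continuous_sitnikovTimeDensity_mul_sin {v : ℝ} (hv : v ^ 2 < 4) :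
    Continuous fun s => sitnikovTimeDensity (v * sin s) :=
  continuousOn_sitnikovTimeDensity.comp_continuous (by fun_prop) (sq_mul_sin_lt hv)

/-- The period of the oscillation which crosses the origin with speed `v`. -/
noncomputable def sitnikovPeriod (v : ℝ) : ℝ :=
  ∫ s in (0 : ℝ)..(2 * π), sitnikovTimeDensity (v * sin s)

lemma sitnikovPeriod_zero : sitnikovPeriod 0 = π / √2 := by
  have h8 : √8 = 2 * √2 := by
    rw [show (8 : ℝ) = 2 ^ 2 * 2 by norm_num, sqrt_mul (by norm_num), sqrt_sq (by norm_num)]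
  simp only [sitnikovPeriod, sitnikovTimeDensity, zero_mul, intervalIntegral.integral_const,
    smul_eq_mul]
  norm_num [h8]
  field_simp

lemma continuousOn_sitnikovPeriod : ContinuousOn sitnikovPeriod {v | v ^ 2 < 4} := by
  rw [continuousOn_iff_continuous_domRestrict]
  refine intervalIntegral.continuous_parametric_intervalIntegral_of_continuous'
    (f := fun (v : {v : ℝ | v ^ 2 < 4}) s => sitnikovTimeDensity (v * sin s)) ?_ 0 (2 * π)
  exact continuousOn_sitnikovTimeDensity.comp_continuous (by fun_prop)
    fun p => sq_mul_sin_lt p.1.2 p.2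

/-- The period blows up as the speed at the origin tends to the escape speed `2`. -/
lemma le_sitnikovPeriod {v δ : ℝ} (hδ : 0 < δ) (hδ1 : δ ≤ 1) (hv : v ^ 2 = 4 - δ ^ 2) :
    1 / (5 * δ) ≤ sitnikovPeriod v := by
  have hv4 : v ^ 2 < 4 := by nlinarith
  have hcont := continuous_sitnikovTimeDensity_mul_sin hv4
  have hpi := pi_gt_three
  calc 1 / (5 * δ) ≤ 1 / (5 * δ ^ 3) := by
        gcongr
        exact pow_le_of_le_one hδ.le hδ1 (by norm_num)
    _ = ∫ _ in (π / 2)..(π / 2 + δ), 5 / (5 * δ ^ 2) ^ 2 := by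
        rw [intervalIntegral.integral_const, smul_eq_mul]
        field_simp
        ring
    _ ≤ ∫ s in (π / 2)..(π / 2 + δ), sitnikovTimeDensity (v * sin s) := by
        refine intervalIntegral.integral_mono_on (by linarith) (by simp)
          (hcont.intervalIntegrable _ _) fun s hs => ?_
        refine div_sq_le_sitnikovTimeDensity (sq_mul_sin_lt hv4 s) ?_
        have hcos : cos s ^ 2 ≤ δ ^ 2 := by
          rw [← sin_pi_div_two_sub, ← sq_abs]
          have h1 : |sin (π / 2 - s)| ≤ |π / 2 - s| := abs_sin_le_abs
          have h2 : |π / 2 - s| ≤ δ := abs_le.2 ⟨by linarith [hs.2], by linarith [hs.1]⟩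
          exact pow_le_pow_left₀ (abs_nonneg _) (h1.trans h2) 2
        rw [mul_pow, sin_sq, hv]
        nlinarith [sq_nonneg (cos s), mul_nonneg (sq_nonneg δ) (sq_nonneg (cos s))]
    _ ≤ sitnikovPeriod v := by
        refine intervalIntegral.integral_mono_interval (by linarith) (by linarith) (by linarith)
          ?_ (hcont.intervalIntegrable _ _)
        exact Filter.Eventually.of_forall fun s =>
          (sitnikovTimeDensity_pos (sq_mul_sin_lt hv4 s)).le

lemma exists_sitnikovPeriod_eq {T : ℝ} (hT : π / √2 < T) :
    ∃ v, 0 < v ∧ v ^ 2 < 4 ∧ sitnikovPeriod v = T := by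
  have hT1 : 1 < T := by
    refine lt_trans ?_ hT
    rw [one_lt_div (by positivity)]
    have : √2 ≤ 2 := sqrt_le_iff.2 ⟨by norm_num, by norm_num⟩
    linarith [pi_gt_three]
  have hδ : 0 < 1 / (5 * T) := by positivity
  have hδ1 : 1 / (5 * T) ≤ 1 := by rw [div_le_one (by positivity)]; linarith
  set δ := 1 / (5 * T) with hδdef
  have hv : √(4 - δ ^ 2) ^ 2 = 4 - δ ^ 2 := sq_sqrt (by nlinarith)
  have hle := le_sitnikovPeriod hδ hδ1 hv
  have hTδ : 1 / (5 * δ) = T := by rw [hδdef]; field_simp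
  rw [hTδ] at hle
  have hlt : ∀ v ∈ Set.Icc 0 √(4 - δ ^ 2), v ^ 2 < 4 := fun v hv' => by
    have := pow_le_pow_left₀ hv'.1 hv'.2 2
    nlinarith
  obtain ⟨v, hvmem, hvT⟩ := intermediate_value_Icc (sqrt_nonneg (4 - δ ^ 2))
    (continuousOn_sitnikovPeriod.mono hlt) ⟨by rw [sitnikovPeriod_zero]; exact hT.le, hle⟩
  refine ⟨v, hvmem.1.lt_of_ne ?_, hlt v hvmem, hvT⟩
  rintro rfl
  rw [sitnikovPeriod_zero] at hvT
  exact hT.ne hvT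

/-- The phase `θ` along the orbit of speed `v` at the origin: the velocity is `v cos θ`. -/
lemma exists_sitnikov_phase {v : ℝ} (hv : v ^ 2 < 4) :
    ∃ θ : ℝ → ℝ, Function.Surjective θ ∧ (∀ t, θ (t + sitnikovPeriod v) = θ t + 2 * π) ∧
      ∀ t, HasDerivAt θ (sitnikovTimeDensity (v * sin (θ t)))⁻¹ t := by
  have hcont := continuous_sitnikovTimeDensity_mul_sin hv
  obtain ⟨θ, hright, hleft, hderiv⟩ := exists_global_inverse_of_hasDerivAt
    (f := fun x => ∫ s in (0 : ℝ)..x, sitnikovTimeDensity (v * sin s))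
    (show (0 : ℝ) < 5 / 4 ^ 2 by norm_num)
    (fun x => (hcont.integral_hasStrictDerivAt 0 x).hasDerivAt)
    fun x => div_sq_le_sitnikovTimeDensity (sq_mul_sin_lt hv x) (by nlinarith)
  refine ⟨θ, fun x => ⟨_, hleft x⟩, fun t => ?_, hderiv⟩
  have hper : Function.Periodic (fun s => sitnikovTimeDensity (v * sin s)) (2 * π) :=
    fun s => by simp only [sin_add_two_pi]
  rw [← hleft (θ t + 2 * π)]
  congr 1
  rw [← intervalIntegral.integral_add_adjacent_intervals (b := θ t)
    (hcont.intervalIntegrable _ _) (hcont.intervalIntegrable _ _), hright,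
    hper.intervalIntegral_add_eq (θ t) 0, zero_add, sitnikovPeriod]

/-- Periodic solutions of the circular Sitnikov problem (Example 7.3): for
every `T > π/√2` the equation `ẍ = -x/(x² + 1/4)^{3/2}` has a non-constant
`T`-periodic solution. -/
theorem sitnikov_periodic_solutions
    (T : ℝ) (hT : π / Real.sqrt 2 < T) :
    ∃ u : ℝ → ℝ,
      ContDiff ℝ 2 u ∧ (∀ t, u (t + T) = u t) ∧
      (∀ t, deriv (deriv u) t = -(u t) / ((u t) ^ 2 + 1 / 4) ^ ((3 : ℝ) / 2)) ∧
      ¬(∃ c : ℝ, ∀ t, u t = c) := by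
  obtain ⟨v, hv0, hv, rfl⟩ := exists_sitnikovPeriod_eq hT
  obtain ⟨θ, hsurj, hper, hθ⟩ := exists_sitnikov_phase hv
  have hw : ∀ t, (v * sin (θ t)) ^ 2 < 4 := fun t => sq_mul_sin_lt hv (θ t)
  have hpos : ∀ t, 0 < sitnikovTimeDensity (v * sin (θ t)) := fun t =>
    sitnikovTimeDensity_pos (hw t)
  have hu : ∀ t, HasDerivAt (fun t => sitnikovPosition (v * sin (θ t))) (v * cos (θ t)) t := by
    intro t
    refine ((hasDerivAt_sitnikovPosition (hw t)).comp t ((hθ t).sin.const_mul v)).congr_deriv ?_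
    have := (hpos t).ne'
    field_simp
  have hu' : ∀ t, HasDerivAt (fun t => v * cos (θ t))
      (-(v * sin (θ t)) * (sitnikovTimeDensity (v * sin (θ t)))⁻¹) t := fun t =>
    ((hθ t).cos.const_mul v).congr_deriv (by ring)
  have hdu := funext fun t => (hu t).deriv
  have hθc : Continuous θ := continuous_iff_continuousAt.2 fun t => (hθ t).continuousAt
  refine ⟨fun t => sitnikovPosition (v * sin (θ t)), ?_, fun t => ?_, fun t => ?_, ?_⟩
  · rw [show (2 : WithTop ℕ∞) = 1 + 1 by norm_num, contDiff_succ_iff_deriv]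
    refine ⟨fun t => (hu t).differentiableAt, by simp, ?_⟩
    rw [hdu, contDiff_one_iff_deriv]
    refine ⟨fun t => (hu' t).differentiableAt, ?_⟩
    rw [funext fun t => (hu' t).deriv]
    have := ((continuous_sitnikovTimeDensity_mul_sin hv).comp hθc).inv₀ fun t => (hpos t).ne'
    exact (by fun_prop : Continuous fun t => -(v * sin (θ t))).mul this
  · simp only [hper, sin_add_two_pi]
  · rw [hdu, (hu' t).deriv, sitnikovPosition_force (hw t)]
  · rintro ⟨c, hc⟩
    obtain ⟨t, ht⟩ := hsurj 0
    have h0 := (hu t).unique ((hasDerivAt_const t c).congr_of_eventuallyEq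
      (Filter.Eventually.of_forall hc))
    simp [ht, hv0.ne'] at h0
end
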